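/- arXiv:1502.02018 — 8 statements merged into one kernel-verified Lean document; each statement's English description precedes it below -/
import Mathlib

section
/- If w ∈ L = f(K) is a simplicial point of L, then the restricted map f|_K is open at every point of the fiber f|_K^{-1}(w). -/
open Set Filter Topology

/-- `f` restricted to `K` (viewed as a map onto `L`, both with subspace topologies) is open at
`v ∈ K` if the image of every neighborhood of `v` in `K` is a neighborhood of `f v` in `L`. -/
def MapsOpenAt {X Y : Type*} [TopologicalSpace X] [TopologicalSpace Y]
    (f : X → Y) (K : Set X) (L : Set Y) (v : X) : Prop :=
  ∀ N : Set X, N ⊆ K → N ∈ nhdsWithin v K → f '' N ∈ nhdsWithin (f v) L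

/-- A simplex is the convex hull of finitely many affinely independent points. -/
def IsSimplex {Y : Type*} [AddCommGroup Y] [Module ℝ Y] (S : Set Y) : Prop :=
  ∃ s : Finset Y, AffineIndependent ℝ (fun p : (s : Set Y) => (p : Y)) ∧
    S = convexHull ℝ (s : Set Y)

/-- `w` is a simplicial point of `C` if finitely many simplices contained in `C`
cover a neighborhood of `w` in `C`. -/
def IsSimplicialPoint {Y : Type*} [AddCommGroup Y] [Module ℝ Y] [TopologicalSpace Y]
    (C : Set Y) (w : Y) : Prop :=
  ∃ (m : ℕ) (S : Fin m → Set Y),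
    (∀ i, IsSimplex (S i) ∧ S i ⊆ C) ∧ (⋃ i, S i) ∈ nhdsWithin w C

/-- Every point of a polytope near `w` lies in the homothetic copy of the polytope
with center `w` and ratio `r`. -/
lemma eventually_mem_convexHull_exists_homothety {Y : Type*} [AddCommGroup Y] [Module ℝ Y]
    [TopologicalSpace Y] [ContinuousAdd Y] [ContinuousSMul ℝ Y] [T2Space Y]
    (s : Finset Y) (w : Y) {r : ℝ} (hr : 0 < r) :
    ∀ᶠ p in 𝓝 w, p ∈ convexHull ℝ (s : Set Y) →
      ∃ q ∈ convexHull ℝ (s : Set Y), p = (1 - r) • w + r • q := by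
  let Φ : (s → ℝ) → Y := fun a => ∑ i, a i • (i : Y)
  have hΦ : Continuous Φ := by fun_prop
  have hull : ∀ p, p ∈ convexHull ℝ (s : Set Y) ↔ ∃ a ∈ stdSimplex ℝ s, Φ a = p := by
    intro p
    rw [Finset.mem_convexHull']
    constructor
    · rintro ⟨a, h0, h1, h2⟩
      refine ⟨fun i => a i, ⟨fun i => h0 i i.2, ?_⟩, ?_⟩
      · rw [← h1]; exact Finset.sum_coe_sort s a
      · rw [← h2]; exact Finset.sum_coe_sort s fun y => a y • y
    · rintro ⟨a, ⟨h0, h1⟩, rfl⟩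
      rw [← Finset.mem_convexHull']
      exact (convex_convexHull ℝ _).sum_mem (fun i _ => h0 i) h1
        (fun i _ => subset_convexHull ℝ _ i.2)
  let U : Set (s → ℝ) := ⋃ l ∈ {l | l ∈ stdSimplex ℝ s ∧ Φ l = w},
    {m | ∀ i, 0 < l i → (1 - r) * l i < m i}
  have hU : IsOpen U := by
    refine isOpen_biUnion fun l _ => ?_
    simp only [ofPred_forall]
    refine isOpen_iInter_of_finite fun i => isOpen_iInter_of_finite fun _ => ?_
    exact isOpen_lt continuous_const (continuous_apply i)
  have hC : IsClosed (Φ '' (stdSimplex ℝ s \ U)) :=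
    (((isCompact_stdSimplex ℝ s).diff hU).image hΦ).isClosed
  have hwC : w ∉ Φ '' (stdSimplex ℝ s \ U) := by
    rintro ⟨l, ⟨hl, hlU⟩, hlw⟩
    exact hlU (mem_biUnion (show l ∈ {l | l ∈ stdSimplex ℝ s ∧ Φ l = w} from ⟨hl, hlw⟩)
      fun i hi => by nlinarith)
  filter_upwards [hC.isOpen_compl.mem_nhds hwC] with p hp hps
  obtain ⟨m, hm, rfl⟩ := (hull p).1 hps
  have hmU : m ∈ U := by
    by_contra h
    exact hp ⟨m, ⟨hm, h⟩, rfl⟩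
  obtain ⟨l, ⟨hl, hlw⟩, hlm⟩ := mem_iUnion₂.1 hmU
  refine ⟨Φ (r⁻¹ • (m - (1 - r) • l)), (hull _).2 ⟨_, ⟨fun i => ?_, ?_⟩, rfl⟩, ?_⟩
  · have : (1 - r) * l i ≤ m i := by
      rcases (hl.1 i).eq_or_lt with h | h
      · rw [← h, mul_zero]; exact hm.1 i
      · exact (hlm i h).le
    simpa using mul_nonneg (inv_nonneg.2 hr.le) (sub_nonneg.2 this)
  · simp only [Pi.smul_apply, Pi.sub_apply, smul_eq_mul, ← Finset.mul_sum,
      Finset.sum_sub_distrib, hm.2, hl.2]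
    field_simp
    ring
  · rw [← hlw]
    simp only [Φ, Finset.smul_sum, ← Finset.sum_add_distrib, smul_smul, ← add_smul]
    refine Finset.sum_congr rfl fun i _ => ?_
    congr 1
    simp only [Pi.smul_apply, Pi.sub_apply, smul_eq_mul]
    field_simp
    ring

theorem simplicial_point_implies_open_on_fiber {X Y : Type*}
    [NormedAddCommGroup X] [NormedSpace ℝ X] [FiniteDimensional ℝ X]
    [NormedAddCommGroup Y] [NormedSpace ℝ Y] [FiniteDimensional ℝ Y]
    (K : Set X) (hKne : K.Nonempty) (hKcomp : IsCompact K) (hKconv : Convex ℝ K)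
    (f : X →ₗ[ℝ] Y) (L : Set Y) (hL : L = f '' K)
    (w : Y) (hw : w ∈ L) (hsimp : IsSimplicialPoint L w) :
    ∀ v ∈ K, f v = w → MapsOpenAt f K L v := by
  rintro v hv rfl N - hN
  subst hL
  obtain ⟨m, S, hS, hSn⟩ := hsimp
  obtain ⟨ε, hε, hεN⟩ := Metric.mem_nhdsWithin_iff.1 hN
  obtain ⟨D, hD, hKD⟩ := hKcomp.isBounded.subset_ball_lt 0 v
  obtain ⟨r, hr0, hr⟩ := exists_between (show 0 < min 1 (ε / D) by positivity)
  have hr1 : r < 1 := hr.trans_le (min_le_left _ _)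
  have hrD : r * D < ε := (lt_div_iff₀ hD).1 (hr.trans_le (min_le_right _ _))
  have key : ∀ᶠ p in 𝓝 (f v), ∀ i, p ∈ S i → ∃ q ∈ S i, p = (1 - r) • f v + r • q := by
    refine eventually_all.2 fun i => ?_
    obtain ⟨s, -, hs⟩ := (hS i).1
    rw [hs]
    exact eventually_mem_convexHull_exists_homothety s (f v) hr0
  filter_upwards [hSn, mem_nhdsWithin_of_mem_nhds key] with p hp hpk
  obtain ⟨i, hi⟩ := mem_iUnion.1 hp
  obtain ⟨q, hq, rfl⟩ := hpk i hi
  obtain ⟨x, hx, rfl⟩ := (hS i).2 hq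
  refine ⟨(1 - r) • v + r • x, hεN ⟨?_, ?_⟩, by simp⟩
  · have hxD : ‖x - v‖ < D := mem_ball_iff_norm.1 (hKD hx)
    have hsub : (1 - r) • v + r • x - v = r • (x - v) := by module
    rw [mem_ball_iff_norm, hsub, norm_smul, Real.norm_of_nonneg hr0.le]
    exact (mul_le_mul_of_nonneg_left hxD.le hr0.le).trans_lt hrD
  · exact hKconv hv hx (by linarith) hr0.le (by ring)
end

section
/- The maximizer H : L → K is continuous at every simplicial point of L. In particular, if L is a polytope then H is continuous, and for every polytope P ⊆ L the restriction H|_P is continuous. -/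
open Set Filter Topology

/-- A polytope is the convex hull of finitely many points. -/
def IsPolytope {Y : Type*} [AddCommGroup Y] [Module ℝ Y] (P : Set Y) : Prop :=
  ∃ t : Finset Y, P = convexHull ℝ (t : Set Y)

/-- Near a point `a` of the standard simplex, every point of the simplex lies in the homothetic
copy of the simplex with center `a` and ratio `ε`. -/
theorem eventually_eq_add_smul_of_mem_stdSimplex {ι : Type*} [Fintype ι] {a : ι → ℝ}
    (ha : a ∈ stdSimplex ℝ ι) {ε : ℝ} (hε : 0 < ε) :
    ∀ᶠ b in 𝓝[stdSimplex ℝ ι] a, ∃ c ∈ stdSimplex ℝ ι, b = (1 - ε) • a + ε • c := by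
  have hle : ∀ᶠ b in 𝓝[stdSimplex ℝ ι] a, ∀ i, (1 - ε) * a i ≤ b i := by
    rw [eventually_all]
    intro i
    rcases (ha.1 i).eq_or_lt with h | h
    · filter_upwards [self_mem_nhdsWithin] with b hb
      simpa [← h] using hb.1 i
    · have hlt : (1 - ε) * a i < a i := by nlinarith
      have hcont : Tendsto (fun b : ι → ℝ => b i) (𝓝[stdSimplex ℝ ι] a) (𝓝 (a i)) :=
        (continuous_apply i).continuousAt.mono_left nhdsWithin_le_nhds
      exact (hcont.eventually (lt_mem_nhds hlt)).mono fun b hb => hb.le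
  filter_upwards [hle, self_mem_nhdsWithin] with b hb hbΔ
  refine ⟨ε⁻¹ • (b - (1 - ε) • a), ⟨fun i => ?_, ?_⟩, ?_⟩
  · have := hb i
    simp only [Pi.smul_apply, Pi.sub_apply, smul_eq_mul]
    exact mul_nonneg (by positivity) (by linarith)
  · simp only [Pi.smul_apply, Pi.sub_apply, smul_eq_mul, ← Finset.mul_sum,
      Finset.sum_sub_distrib, ha.2, hbΔ.2]
    field_simp
    ring
  · rw [smul_inv_smul₀ hε.ne']
    abel

/-- If the fibers of `f` on the compact set `K` vary lower semicontinuously along `φ`, then the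
unique maximizers of `g` over these fibers converge. -/
theorem tendsto_maximizer_of_fiber_lowerSemicontinuous {X Y T : Type*}
    [TopologicalSpace X] [TopologicalSpace Y] [T2Space Y]
    {K : Set X} (hK : IsCompact K) {f : X → Y} (hf : Continuous f)
    {g : X → ℝ} (hg : ContinuousOn g K) {L : Set Y} {H : Y → X}
    (hHmem : ∀ w ∈ L, H w ∈ K ∧ f (H w) = w)
    (hHmax : ∀ w ∈ L, ∀ v ∈ K, f v = w → g v ≤ g (H w))
    (hHuniq : ∀ w ∈ L, ∀ v ∈ K, f v = w → g v = g (H w) → v = H w)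
    {F : Filter T} {φ : T → Y} {w : Y} (hw : w ∈ L) (hφ : Tendsto φ F (𝓝 w))
    (hφL : ∀ᶠ t in F, φ t ∈ L)
    (hlsc : ∀ U ∈ 𝓝[K] (H w), ∀ᶠ t in F, ∃ v ∈ K, v ∈ U ∧ f v = φ t) :
    Tendsto (fun t => H (φ t)) F (𝓝 (H w)) := by
  have hmem : ∀ᶠ t in F, H (φ t) ∈ K := hφL.mono fun t ht => (hHmem _ ht).1
  refine hK.tendsto_nhds_of_unique_mapClusterPt hmem fun v hv hcl => ?_
  have hfv : f v = w := by
    have h1 : MapClusterPt (f v) F (f ∘ fun t => H (φ t)) :=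
      hcl.continuousAt_comp hf.continuousAt
    have h2 : Tendsto (f ∘ fun t => H (φ t)) F (𝓝 w) :=
      hφ.congr' (hφL.mono fun t ht => ((hHmem _ ht).2).symm)
    by_contra hne
    have h3 : ClusterPt (f v) (𝓝 w) := ClusterPt.mono h1 h2
    exact hne (eq_of_nhds_neBot h3)
  refine hHuniq w hw v hv hfv (le_antisymm (hHmax w hw v hv hfv) ?_)
  by_contra! hlt
  obtain ⟨c, hc1, hc2⟩ := exists_between hlt
  have hev : ∀ᶠ t in F, c < g (H (φ t)) := by
    filter_upwards [hφL, hlsc _ ((hg _ (hHmem w hw).1).eventually (lt_mem_nhds hc2))]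
      with t ht ⟨v', hv'K, hv'c, hv'f⟩
    exact lt_of_lt_of_le hv'c (hHmax _ ht v' hv'K hv'f)
  have hnear : ∀ᶠ x in 𝓝 v, x ∈ K → g x < c :=
    eventually_nhdsWithin_iff.1 ((hg v hv).eventually (gt_mem_nhds hc1))
  obtain ⟨t, ht1, ht2, ht3⟩ := ((hcl.frequently hnear).and_eventually (hev.and hmem)).exists
  exact lt_asymm (ht1 ht3) ht2

/-- A function on the image of a compact set is continuous if its pullback is. -/
theorem ContinuousOn.of_comp_isCompact_image {A B C : Type*} [TopologicalSpace A]
    [TopologicalSpace B] [T2Space B] [TopologicalSpace C] {s : Set A} (hs : IsCompact s)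
    {φ : A → B} (hφ : ContinuousOn φ s) {h : B → C} (hh : ContinuousOn (h ∘ φ) s) :
    ContinuousOn h (φ '' s) := by
  have : CompactSpace s := isCompact_iff_compactSpace.1 hs
  let ψ : s → φ '' s := (mapsTo_image φ s).restrict
  have hψ : Continuous ψ := hφ.mapsToRestrict (mapsTo_image φ s)
  have hq : IsQuotientMap ψ :=
    hψ.isClosedMap.isQuotientMap hψ (surjective_mapsTo_image_restrict φ s)
  rw [continuousOn_iff_continuous_domRestrict] at hh ⊢
  exact hq.continuous_iff.2 hh

theorem IsSimplex.isPolytope {Y : Type*} [AddCommGroup Y] [Module ℝ Y] {S : Set Y}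
    (hS : IsSimplex S) : IsPolytope S :=
  let ⟨s, _, hs⟩ := hS
  ⟨s, hs⟩

theorem IsPolytope.isClosed {Y : Type*} [NormedAddCommGroup Y] [NormedSpace ℝ Y] {P : Set Y}
    (hP : IsPolytope P) : IsClosed P := by
  obtain ⟨t, rfl⟩ := hP
  exact t.finite_toSet.isClosed_convexHull ℝ

theorem IsPolytope.continuousOn_maximizer {X Y : Type*}
    [NormedAddCommGroup X] [NormedSpace ℝ X] [FiniteDimensional ℝ X]
    [NormedAddCommGroup Y] [NormedSpace ℝ Y]
    {K : Set X} (hKcomp : IsCompact K) (hKconv : Convex ℝ K)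
    (f : X →ₗ[ℝ] Y) {L : Set Y} {g : X → ℝ} (hg : ContinuousOn g K) {H : Y → X}
    (hHmem : ∀ w ∈ L, H w ∈ K ∧ f (H w) = w)
    (hHmax : ∀ w ∈ L, ∀ v ∈ K, f v = w → g v ≤ g (H w))
    (hHuniq : ∀ w ∈ L, ∀ v ∈ K, f v = w → g v = g (H w) → v = H w)
    {P : Set Y} (hP : IsPolytope P) (hPL : P ⊆ L) : ContinuousOn H P := by
  obtain ⟨t, rfl⟩ := hP
  obtain ⟨_, A, hPA⟩ : ∃ (_ : Fintype (t : Set Y)) (A : (↥(t : Set Y) → ℝ) →ₗ[ℝ] Y),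
      convexHull ℝ (t : Set Y) = A '' stdSimplex ℝ (t : Set Y) :=
    ⟨_, _, t.finite_toSet.convexHull_eq_image⟩
  rw [hPA] at hPL ⊢
  have hA : Continuous A := A.continuous_of_finiteDimensional
  suffices h : ContinuousOn (H ∘ A) (stdSimplex ℝ (t : Set Y)) from
    ContinuousOn.of_comp_isCompact_image (isCompact_stdSimplex ℝ _) hA.continuousOn h
  intro a ha
  have hAL : ∀ b ∈ stdSimplex ℝ (t : Set Y), A b ∈ L := fun b hb =>
    hPL (mem_image_of_mem A hb)
  refine tendsto_maximizer_of_fiber_lowerSemicontinuous (f := f) hKcomp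
    f.continuous_of_finiteDimensional hg hHmem hHmax hHuniq (hAL a ha)
    hA.continuousWithinAt (eventually_nhdsWithin_of_forall hAL) fun U hU => ?_
  obtain ⟨δ, hδ, hδU⟩ := Metric.mem_nhdsWithin_iff.1 hU
  obtain ⟨D, hD, hKD⟩ := hKcomp.isBounded.subset_ball_lt 0 (H (A a))
  obtain ⟨ε, hε, hεlt⟩ : ∃ ε, 0 < ε ∧ ε < min 1 (δ / D) :=
    exists_between (lt_min one_pos (div_pos hδ hD))
  have hεδ : ε * D < δ := (lt_div_iff₀ hD).1 (hεlt.trans_le (min_le_right _ _))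
  have hε1 : ε < 1 := hεlt.trans_le (min_le_left _ _)
  filter_upwards [eventually_eq_add_smul_of_mem_stdSimplex ha hε] with b ⟨c, hc, hbc⟩
  obtain ⟨hqK, hqf⟩ := hHmem _ (hAL c hc)
  obtain ⟨haK, haf⟩ := hHmem _ (hAL a ha)
  have hvK : (1 - ε) • H (A a) + ε • H (A c) ∈ K :=
    hKconv haK hqK (by linarith) hε.le (by ring)
  refine ⟨_, hvK, hδU ⟨?_, hvK⟩, by simp [hbc, haf, hqf]⟩
  have hdist : (1 - ε) • H (A a) + ε • H (A c) - H (A a) = ε • (H (A c) - H (A a)) := by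
    module
  rw [Metric.mem_ball, dist_eq_norm, hdist, norm_smul, Real.norm_of_nonneg hε.le,
    ← dist_eq_norm]
  exact (mul_le_mul_of_nonneg_left (Metric.mem_ball.1 (hKD hqK)).le hε.le).trans_lt hεδ

theorem maximizer_continuous_at_simplicial_points {X Y : Type*}
    [NormedAddCommGroup X] [NormedSpace ℝ X] [FiniteDimensional ℝ X]
    [NormedAddCommGroup Y] [NormedSpace ℝ Y] [FiniteDimensional ℝ Y]
    (K : Set X) (hKne : K.Nonempty) (hKcomp : IsCompact K) (hKconv : Convex ℝ K)
    (f : X →ₗ[ℝ] Y) (L : Set Y) (hL : L = f '' K)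
    (g : X → ℝ) (hg : ContinuousOn g K)
    (H : Y → X)
    -- `H w` is the unique maximizer of `g` on the fiber of `w`, for every `w ∈ L`:
    (hHmem : ∀ w ∈ L, H w ∈ K ∧ f (H w) = w)
    (hHmax : ∀ w ∈ L, ∀ v ∈ K, f v = w → g v ≤ g (H w))
    (hHuniq : ∀ w ∈ L, ∀ v ∈ K, f v = w → g v = g (H w) → v = H w) :
    (∀ w ∈ L, IsSimplicialPoint L w → ContinuousWithinAt H L w) ∧
    (IsPolytope L → ContinuousOn H L) ∧
    (∀ P : Set Y, IsPolytope P → P ⊆ L → ContinuousOn H P) := by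
  have hpoly : ∀ P : Set Y, IsPolytope P → P ⊆ L → ContinuousOn H P := fun P hP hPL =>
    hP.continuousOn_maximizer hKcomp hKconv f hg hHmem hHmax hHuniq hPL
  refine ⟨fun w _ ⟨m, S, hS, hnhds⟩ => ?_, fun h => hpoly L h subset_rfl, hpoly⟩
  refine ContinuousWithinAt.mono_of_mem_nhdsWithin ?_ hnhds
  rw [ContinuousWithinAt, nhdsWithin_iUnion, tendsto_iSup]
  intro i
  have hPi := (hS i).1.isPolytope
  by_cases hwi : w ∈ S i
  · exact hpoly _ hPi (hS i).2 w hwi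
  · exact continuousWithinAt_of_notMem_closure (by rwa [hPi.isClosed.closure_eq])
end

section
/- Let K̃ := f|_K^{-1}(rb(L)) be the preimage of the relative boundary of L. Then for every point ṽ ∈ K̃, the map f|_K (from K onto L) is open at ṽ if and only if the restriction f|_{K̃} (from K̃ onto rb(L)) is open at ṽ. -/
open Set Filter Topology

/-- The relative boundary of a convex set: its closure minus its relative interior. -/
def relBoundary {Y : Type*} [NormedAddCommGroup Y] [NormedSpace ℝ Y] (C : Set Y) : Set Y :=
  closure C \ intrinsicInterior ℝ C

/-- The relative interior consists of the points of the affine span having a relative ball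
inside the set. -/
theorem mem_intrinsicInterior_iff_ball {Y : Type*} [NormedAddCommGroup Y] [NormedSpace ℝ Y]
    {C : Set Y} {x : Y} :
    x ∈ intrinsicInterior ℝ C ↔ x ∈ affineSpan ℝ C ∧
      ∃ r > 0, ∀ y ∈ affineSpan ℝ C, ‖y - x‖ < r → y ∈ C := by
  rw [mem_intrinsicInterior]
  constructor
  · rintro ⟨y, hy, rfl⟩
    refine ⟨y.2, ?_⟩
    rw [mem_interior_iff_mem_nhds, Metric.mem_nhds_iff] at hy
    obtain ⟨r, hr, h⟩ := hy
    refine ⟨r, hr, fun z hz hzr => ?_⟩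
    have hmem : (⟨z, hz⟩ : affineSpan ℝ C) ∈ Metric.ball y r := by
      rw [Metric.mem_ball, Subtype.dist_eq, dist_eq_norm]
      exact hzr
    exact h hmem
  · rintro ⟨hx, r, hr, h⟩
    refine ⟨⟨x, hx⟩, ?_, rfl⟩
    rw [mem_interior_iff_mem_nhds, Metric.mem_nhds_iff]
    refine ⟨r, hr, fun z hz => h z z.2 ?_⟩
    rwa [Metric.mem_ball, Subtype.dist_eq, dist_eq_norm] at hz

/-- A relative ball around `c`, contracted towards a point `q` of a convex set, stays inside the
set. -/
theorem Convex.relative_ball_subset {Y : Type*} [NormedAddCommGroup Y] [NormedSpace ℝ Y]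
    {C : Set Y} (hC : Convex ℝ C) {c q : Y} {r t : ℝ} (hc : c ∈ affineSpan ℝ C)
    (hball : ∀ y ∈ affineSpan ℝ C, ‖y - c‖ < r → y ∈ C) (hq : q ∈ C) (ht0 : 0 < t) (ht1 : t ≤ 1)
    {p : Y} (hp : p ∈ affineSpan ℝ C) (hpt : ‖p - ((1 - t) • q + t • c)‖ < t * r) : p ∈ C := by
  set m := (1 - t) • q + t • c with hm
  have hmA : m ∈ affineSpan ℝ C :=
    (affineSpan ℝ C).convex (subset_affineSpan ℝ C hq) hc (by linarith) ht0.le (by ring)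
  have hz : c + t⁻¹ • (p - m) ∈ affineSpan ℝ C := by
    have := AffineSubspace.vadd_mem_of_mem_direction
      ((affineSpan ℝ C).direction.smul_mem t⁻¹ (AffineSubspace.vsub_mem_direction hp hmA)) hc
    simpa [add_comm] using this
  have hzC : c + t⁻¹ • (p - m) ∈ C := by
    refine hball _ hz ?_
    rw [add_sub_cancel_left, norm_smul, norm_inv, Real.norm_of_nonneg ht0.le,
      inv_mul_lt_iff₀ ht0]
    exact hpt
  have := hC hq hzC (sub_nonneg.2 ht1) ht0.le (by ring)
  rwa [smul_add, smul_inv_smul₀ ht0.ne', ← add_assoc, ← hm, add_sub_cancel] at this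

/-- A point of a convex set close to a relative boundary point `w` lies on a segment from a
relative interior point `c` to a relative boundary point, with a small weight at `c`. -/
theorem Convex.exists_boundary_combination {Y : Type*} [NormedAddCommGroup Y] [NormedSpace ℝ Y]
    {C : Set Y} (hC : Convex ℝ C) (hcomp : IsCompact C) {c w w' : Y} {r : ℝ}
    (hc : c ∈ C) (hball : ∀ y ∈ affineSpan ℝ C, ‖y - c‖ < r → y ∈ C)
    (hw : w ∈ C) (hwri : w ∉ intrinsicInterior ℝ C) (hw' : w' ∈ C) (hlt : ‖w' - w‖ < r) :
    ∃ q ∈ C, q ∉ intrinsicInterior ℝ C ∧ ∃ t : ℝ, 0 ≤ t ∧ t ≤ 1 ∧ t * r ≤ ‖w' - w‖ ∧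
      w' = (1 - t) • q + t • c := by
  have hcA := subset_affineSpan ℝ C hc
  have weight_le : ∀ q ∈ C, ∀ t : ℝ, 0 ≤ t → t ≤ 1 → w' = (1 - t) • q + t • c →
      t * r ≤ ‖w' - w‖ := by
    intro q hq t ht0 ht1 heq
    by_contra! hcon
    have htpos : 0 < t := by
      by_contra! h
      have : t = 0 := le_antisymm h ht0
      subst this
      linarith [norm_nonneg (w' - w)]
    refine hwri (mem_intrinsicInterior_iff_ball.2 ⟨subset_affineSpan ℝ C hw,
      t * r - ‖w' - w‖, sub_pos.2 hcon, fun y hy hyr => ?_⟩)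
    refine hC.relative_ball_subset hcA hball hq htpos ht1 hy ?_
    rw [← heq]
    have := norm_sub_le_norm_sub_add_norm_sub y w w'
    rw [norm_sub_rev w w'] at this
    linarith
  have hne : w' - c ≠ 0 := by
    intro h
    have := weight_le c hc 1 zero_le_one le_rfl (by simp [sub_eq_zero.1 h])
    linarith
  have hnorm : 0 < ‖w' - c‖ := norm_pos_iff.2 hne
  let S : Set ℝ := {s | c + s • (w' - c) ∈ C}
  have hSclosed : IsClosed S := hcomp.isClosed.preimage (by fun_prop)
  have h1S : (1 : ℝ) ∈ S := by simpa [S] using hw'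
  obtain ⟨B, hB⟩ := hcomp.isBounded.exists_norm_le
  have hSbdd : BddAbove S := by
    refine ⟨(B + ‖c‖) / ‖w' - c‖, fun s hs => ?_⟩
    rw [le_div_iff₀ hnorm]
    calc s * ‖w' - c‖ ≤ ‖s • (w' - c)‖ := by
          rw [norm_smul]
          exact mul_le_mul_of_nonneg_right (le_abs_self s) hnorm.le
      _ = ‖(c + s • (w' - c)) - c‖ := by rw [add_sub_cancel_left]
      _ ≤ ‖c + s • (w' - c)‖ + ‖c‖ := norm_sub_le _ _
      _ ≤ B + ‖c‖ := by linarith [hB _ hs]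
  set s := sSup S
  have hs : s ∈ S := hSclosed.csSup_mem ⟨1, h1S⟩ hSbdd
  have h1s : 1 ≤ s := le_csSup hSbdd h1S
  have hs0 : 0 < s := by linarith
  have hinv : s⁻¹ ≤ 1 := inv_le_one_of_one_le₀ h1s
  have heq : w' = (1 - (1 - s⁻¹)) • (c + s • (w' - c)) + (1 - s⁻¹) • c := by
    rw [sub_sub_cancel, smul_add, inv_smul_smul₀ hs0.ne', sub_smul, one_smul]
    abel
  have ht0 : 0 ≤ 1 - s⁻¹ := by linarith
  have ht1 : 1 - s⁻¹ ≤ 1 := by linarith [inv_pos.2 hs0]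
  refine ⟨_, hs, fun hri => ?_, 1 - s⁻¹, ht0, ht1, weight_le _ hs _ ht0 ht1 heq, heq⟩
  obtain ⟨-, ρ, hρ, hρball⟩ := mem_intrinsicInterior_iff_ball.1 hri
  have hη : 0 < ρ / (2 * ‖w' - c‖) := by positivity
  have hmem : s + ρ / (2 * ‖w' - c‖) ∈ S := by
    refine hρball _ ?_ ?_
    · have := AffineMap.lineMap_mem (s + ρ / (2 * ‖w' - c‖)) hcA (subset_affineSpan ℝ C hw')
      simpa [AffineMap.lineMap_apply, add_comm] using this
    · rw [add_sub_add_left_eq_sub, ← sub_smul, add_sub_cancel_left, norm_smul,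
        Real.norm_of_nonneg hη.le]
      have : ρ / (2 * ‖w' - c‖) * ‖w' - c‖ = ρ / 2 := by field_simp
      linarith
  linarith [le_csSup hSbdd hmem]

/-- Openness at a point passes to the restriction to a full preimage. -/
theorem MapsOpenAt.restrict_preimage {X Y : Type*} [TopologicalSpace X] [TopologicalSpace Y]
    {f : X → Y} {K : Set X} {L M : Set Y} {v : X} (h : MapsOpenAt f K L v) (hML : M ⊆ L) :
    MapsOpenAt f {v ∈ K | f v ∈ M} M v := by
  intro N _ hN
  obtain ⟨U, hU, hUN⟩ := mem_nhdsWithin_iff_exists_mem_nhds_inter.1 hN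
  have hUK := h (U ∩ K) inter_subset_right
    (inter_mem (mem_nhdsWithin_of_mem_nhds hU) self_mem_nhdsWithin)
  filter_upwards [nhdsWithin_mono _ hML hUK, self_mem_nhdsWithin]
  rintro _ ⟨x, ⟨hxU, hxK⟩, rfl⟩ hxM
  exact ⟨x, hUN ⟨hxU, hxK, hxM⟩, rfl⟩

theorem openness_iff_openness_on_boundary_preimage {X Y : Type*}
    [NormedAddCommGroup X] [NormedSpace ℝ X] [FiniteDimensional ℝ X]
    [NormedAddCommGroup Y] [NormedSpace ℝ Y] [FiniteDimensional ℝ Y]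
    (K : Set X) (hKne : K.Nonempty) (hKcomp : IsCompact K) (hKconv : Convex ℝ K)
    (f : X →ₗ[ℝ] Y) (L : Set Y) (hL : L = f '' K)
    (Kt : Set X) (hKt : Kt = {v ∈ K | f v ∈ relBoundary L}) :
    ∀ vt ∈ Kt, (MapsOpenAt f K L vt ↔ MapsOpenAt f Kt (relBoundary L) vt) := by
  have hLcomp : IsCompact L := hL ▸ hKcomp.image f.continuous_of_finiteDimensional
  have hLconv : Convex ℝ L := hL ▸ hKconv.linear_image f
  have hLne : L.Nonempty := hL ▸ hKne.image f
  have hbd : relBoundary L = L \ intrinsicInterior ℝ L := by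
    rw [relBoundary, hLcomp.isClosed.closure_eq]
  subst hKt
  rintro vt ⟨hvtK, hvtb⟩
  refine ⟨fun h => h.restrict_preimage (hbd ▸ sdiff_subset), fun h N _ hN => ?_⟩
  obtain ⟨c, hcri⟩ := hLne.intrinsicInterior hLconv
  have hcL : c ∈ L := intrinsicInterior_subset hcri
  obtain ⟨-, r, hr, hball⟩ := mem_intrinsicInterior_iff_ball.1 hcri
  obtain ⟨v₀, hv₀K, hv₀⟩ : c ∈ f '' K := hL ▸ hcL
  obtain ⟨ε, hε, hεN⟩ := Metric.mem_nhdsWithin_iff.1 hN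
  have hδ := h (Metric.ball vt (ε / 2) ∩ {v ∈ K | f v ∈ relBoundary L}) inter_subset_right
    (inter_mem (mem_nhdsWithin_of_mem_nhds (Metric.ball_mem_nhds vt (half_pos hε)))
      self_mem_nhdsWithin)
  obtain ⟨δ, hδ0, hδ⟩ := Metric.mem_nhdsWithin_iff.1 hδ
  obtain ⟨D, hD0, hD⟩ : ∃ D > 0, ∀ q ∈ L, ‖q - c‖ ≤ D := by
    obtain ⟨B, hB⟩ := hLcomp.isBounded.exists_norm_le
    refine ⟨|B| + ‖c‖ + 1, by positivity, fun q hq => ?_⟩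
    linarith [norm_sub_le q c, hB q hq, le_abs_self B]
  have hM0 : 0 < ‖v₀ - vt‖ + 1 := by positivity
  obtain ⟨τ, hτ0, hτM, hτD⟩ : ∃ τ > 0, τ * (‖v₀ - vt‖ + 1) ≤ ε / 2 ∧ τ * D ≤ δ / 2 :=
    ⟨min (ε / 2 / (‖v₀ - vt‖ + 1)) (δ / 2 / D), by positivity,
      (le_div_iff₀ hM0).1 (min_le_left _ _), (le_div_iff₀ hD0).1 (min_le_right _ _)⟩
  refine Metric.mem_nhdsWithin_iff.2 ⟨min r (min (δ / 2) (τ * r)), by positivity, ?_⟩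
  rintro w' ⟨hw'ball, hw'L⟩
  rw [Metric.mem_ball, dist_eq_norm, lt_min_iff, lt_min_iff] at hw'ball
  obtain ⟨hw'r, hw'δ, hw'τ⟩ := hw'ball
  have hvtb' := hbd ▸ hvtb
  obtain ⟨q, hqL, hqri, t, ht0, ht1, htr, heq⟩ :=
    hLconv.exists_boundary_combination hLcomp hcL hball hvtb'.1 hvtb'.2 hw'L hw'r
  have htτ : t < τ := lt_of_mul_lt_mul_right (htr.trans_lt hw'τ) hr.le
  have hqδ : ‖q - f vt‖ < δ := by
    have hdecomp : q - f vt = (w' - f vt) + t • (q - c) := by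
      rw [heq]
      module
    calc ‖q - f vt‖ ≤ ‖w' - f vt‖ + ‖t • (q - c)‖ := hdecomp ▸ norm_add_le _ _
      _ ≤ ‖w' - f vt‖ + τ * D := by
        rw [norm_smul, Real.norm_of_nonneg ht0]
        gcongr
        exact hD q hqL
      _ < δ := by linarith
  obtain ⟨v, ⟨hvball, hvK, -⟩, hvq⟩ :=
    hδ ⟨by rwa [Metric.mem_ball, dist_eq_norm], hbd.symm ▸ mem_sdiff_of_mem hqL hqri⟩
  rw [Metric.mem_ball, dist_eq_norm] at hvball
  refine ⟨(1 - t) • v + t • v₀, hεN ⟨?_, hKconv hvK hv₀K (by linarith) ht0 (by ring)⟩, ?_⟩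
  · rw [Metric.mem_ball, dist_eq_norm]
    have hdecomp : (1 - t) • v + t • v₀ - vt = (1 - t) • (v - vt) + t • (v₀ - vt) := by module
    rw [hdecomp]
    calc ‖(1 - t) • (v - vt) + t • (v₀ - vt)‖
        ≤ (1 - t) * ‖v - vt‖ + t * ‖v₀ - vt‖ := by
          refine (norm_add_le _ _).trans_eq ?_
          rw [norm_smul, norm_smul, Real.norm_of_nonneg ht0,
            Real.norm_of_nonneg (sub_nonneg.2 ht1)]
      _ ≤ 1 * ‖v - vt‖ + τ * (‖v₀ - vt‖ + 1) := by
          gcongr <;> linarith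
      _ < ε := by linarith
  · rw [map_add, map_smul, map_smul, hvq, hv₀, heq]
end

section
/- If F is a facet of L (i.e., a face of L of dimension dim(L) − 1) and w ∈ ri(F), then f|_K is open at every point of the fiber f|_K^{-1}(w). -/
open Set Filter Topology

/-- A face of a convex set `C`: a convex subset `F ⊆ C` such that any segment of `C` whose
relative interior meets `F` lies in `F` (i.e. `F` is convex and extreme in `C`). -/
def IsFaceOf {Y : Type*} [AddCommGroup Y] [Module ℝ Y] (C F : Set Y) : Prop :=
  Convex ℝ F ∧ IsExtreme ℝ C F

/-- The dimension of a convex set: the dimension of its affine hull. -/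
noncomputable def convDim {Y : Type*} [NormedAddCommGroup Y] [NormedSpace ℝ Y]
    (C : Set Y) : ℕ :=
  Module.finrank ℝ (affineSpan ℝ C).direction

/-- If `w` lies in the intrinsic interior of `F`, then `F` contains all small translates of `w`
along the direction of its affine span. -/
theorem exists_pos_add_mem_of_mem_intrinsicInterior {Y : Type*} [NormedAddCommGroup Y]
    [NormedSpace ℝ Y] {F : Set Y} {w : Y} (hw : w ∈ intrinsicInterior ℝ F) :
    ∃ r > 0, ∀ e ∈ (affineSpan ℝ F).direction, ‖e‖ < r → w + e ∈ F := by
  obtain ⟨y, hy, rfl⟩ := mem_intrinsicInterior.1 hw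
  obtain ⟨r, hr, hball⟩ := Metric.mem_nhds_iff.1 (mem_interior_iff_mem_nhds.1 hy)
  refine ⟨r, hr, fun e he hlt ↦ ?_⟩
  have hmem : (y : Y) + e ∈ affineSpan ℝ F := by
    simpa [add_comm] using AffineSubspace.vadd_mem_of_mem_direction he y.2
  exact hball (show (⟨(y : Y) + e, hmem⟩ : affineSpan ℝ F) ∈ Metric.ball y r by
    simpa [Metric.mem_ball, Subtype.dist_eq] using hlt)

/-- A subspace of codimension one in `V` is cut out in `V` by a functional normalized at a
suitable generator of `V`. -/
theorem Submodule.exists_dual_eq_one_of_notMem {Y : Type*} [AddCommGroup Y] [Module ℝ Y]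
    [FiniteDimensional ℝ Y] {E V : Submodule ℝ Y} (hEV : E ≤ V)
    (hrank : Module.finrank ℝ E + 1 = Module.finrank ℝ V) {p : Y} (hpV : p ∈ V) (hpE : p ∉ E) :
    ∃ φ : Y →ₗ[ℝ] ℝ, φ p = 1 ∧ (∀ e ∈ E, φ e = 0) ∧ ∀ d ∈ V, d - φ d • p ∈ E := by
  obtain ⟨ψ, hψp, hψE⟩ := Submodule.exists_le_ker_of_notMem hpE
  have hφp : ((ψ p)⁻¹ • ψ) p = 1 := by simp [hψp]
  have hφE : ∀ e ∈ E, ((ψ p)⁻¹ • ψ) e = 0 := fun e he ↦ by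
    simp [show ψ e = 0 from hψE he]
  refine ⟨(ψ p)⁻¹ • ψ, hφp, hφE, fun d hd ↦ ?_⟩
  have hlt : E < E ⊔ ℝ ∙ p := lt_of_le_of_ne le_sup_left fun h ↦
    hpE (h ▸ Submodule.mem_sup_right (Submodule.mem_span_singleton_self p))
  have hle : E ⊔ ℝ ∙ p ≤ V := sup_le hEV ((Submodule.span_singleton_le_iff_mem p V).2 hpV)
  have hsup : E ⊔ ℝ ∙ p = V := by
    refine Submodule.eq_of_le_of_finrank_le hle ?_
    have := Submodule.finrank_lt_finrank_of_lt hlt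
    omega
  rw [← hsup] at hd
  obtain ⟨e, he, x, hx, rfl⟩ := Submodule.mem_sup.1 hd
  obtain ⟨c, rfl⟩ := Submodule.mem_span_singleton.1 hx
  have : ((ψ p)⁻¹ • ψ) (e + c • p) = c := by
    rw [map_add, map_smul, hφE e he, hφp]; simp
  simpa [this] using he

/-- A convex set lies on one side of the affine hull of a face of codimension one. -/
theorem IsFaceOf.dual_nonneg {Y : Type*} [NormedAddCommGroup Y] [NormedSpace ℝ Y] {L F : Set Y}
    (hL : Convex ℝ L) (hF : IsFaceOf L F) {w p : Y} (hwF : w ∈ F) (hp : w + p ∈ L) {r : ℝ}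
    (hr : 0 < r) (hball : ∀ e ∈ (affineSpan ℝ F).direction, ‖e‖ < r → w + e ∈ F)
    {φ : Y →ₗ[ℝ] ℝ} (hφp : φ p = 1) (hφE : ∀ e ∈ (affineSpan ℝ F).direction, φ e = 0)
    {d : Y} (hd : w + d ∈ L) (hdE : d - φ d • p ∈ (affineSpan ℝ F).direction) :
    0 ≤ φ d := by
  by_contra! ha
  set a := φ d
  set e := d - a • p with he
  have hwL : w ∈ L := hF.2.1 hwF
  have hpos : 0 < r + ‖e‖ := by positivity
  set t := r / (r + ‖e‖) with ht
  have ht0 : 0 < t := by positivity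
  have ht1 : t ≤ 1 := (div_le_one hpos).2 (by linarith [norm_nonneg e])
  have hscale : ∀ x, w + x ∈ L → w + t • x ∈ L := fun x hx ↦
    hL.add_smul_mem hwL hx ⟨ht0.le, ht1⟩
  have ha1 : 0 < 1 - a := by linarith
  have hz : w + (t / (1 - a)) • e ∈ F := by
    refine hball _ (Submodule.smul_mem _ _ hdE) ?_
    rw [norm_smul, Real.norm_of_nonneg (by positivity)]
    have h1 : t / (1 - a) ≤ t := div_le_self ht0.le (by linarith)
    have h2 : t * ‖e‖ < r := by
      rw [ht, div_mul_eq_mul_div, div_lt_iff₀ hpos]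
      nlinarith
    exact (mul_le_mul_of_nonneg_right h1 (norm_nonneg e)).trans_lt h2
  have hseg : w + (t / (1 - a)) • e ∈ openSegment ℝ (w + t • p) (w + t • d) := by
    refine ⟨-a / (1 - a), 1 / (1 - a), div_pos (by linarith) ha1, by positivity, ?_, ?_⟩
    · field_simp; ring
    · rw [he]
      match_scalars <;> field_simp
      ring
  have hmem : w + t • p ∈ F :=
    hF.2.left_mem_of_mem_openSegment (hscale p hp) (hscale d hd) hz hseg
  have hdir : t • p ∈ (affineSpan ℝ F).direction := by
    simpa using AffineSubspace.vsub_mem_direction (subset_affineSpan ℝ F hmem)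
      (subset_affineSpan ℝ F hwF)
  have := hφE _ hdir
  rw [map_smul, hφp, smul_eq_mul, mul_one] at this
  exact ht0.ne' this

/-- Near a relative interior point `w` of a facet, a convex set coincides with the cone with
apex `w` it generates. -/
theorem IsFaceOf.exists_pos_add_smul_mem {Y : Type*} [NormedAddCommGroup Y] [NormedSpace ℝ Y]
    [FiniteDimensional ℝ Y] {L F : Set Y} (hL : Convex ℝ L) (hF : IsFaceOf L F)
    (hfacet : convDim F + 1 = convDim L) {w : Y} (hw : w ∈ intrinsicInterior ℝ F) :
    ∃ δ > 0, ∀ d (s : ℝ), w + d ∈ L → 0 ≤ s → ‖s • d‖ < δ → w + s • d ∈ L := by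
  have hwF : w ∈ F := intrinsicInterior_subset hw
  have hwL : w ∈ L := hF.2.1 hwF
  obtain ⟨r, hr, hball⟩ := exists_pos_add_mem_of_mem_intrinsicInterior hw
  have hdirL : ∀ d, w + d ∈ L → d ∈ (affineSpan ℝ L).direction := fun d hd ↦ by
    simpa using AffineSubspace.vsub_mem_direction (subset_affineSpan ℝ L hd)
      (subset_affineSpan ℝ L hwL)
  have hEV : (affineSpan ℝ F).direction ≤ (affineSpan ℝ L).direction :=
    AffineSubspace.direction_le (affineSpan_mono ℝ hF.2.1)
  obtain ⟨p, hp, hpE⟩ : ∃ p, w + p ∈ L ∧ p ∉ (affineSpan ℝ F).direction := by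
    by_contra! h
    have hle : (affineSpan ℝ L).direction ≤ (affineSpan ℝ F).direction := by
      refine AffineSubspace.direction_le (affineSpan_le.2 fun x hx ↦ ?_)
      have := AffineSubspace.vadd_mem_of_mem_direction (h (x - w) (by simpa using hx))
        (subset_affineSpan ℝ F hwF)
      simpa using this
    have := Submodule.finrank_mono hle
    simp only [convDim] at hfacet
    omega
  obtain ⟨φ, hφp, hφE, hφV⟩ :=
    Submodule.exists_dual_eq_one_of_notMem hEV hfacet (hdirL p hp) hpE
  have hφc : Continuous φ := φ.continuous_of_finiteDimensional
  have h1 : ∀ᶠ x in 𝓝 (0 : Y), φ x < 1 / 2 :=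
    hφc.continuousAt.eventually_lt_const (by simp)
  have h2 : ∀ᶠ x in 𝓝 (0 : Y), ‖(2 : ℝ) • (x - φ x • p)‖ < r := by
    have : Continuous fun x : Y ↦ ‖(2 : ℝ) • (x - φ x • p)‖ := by fun_prop
    exact this.continuousAt.eventually_lt_const (by simpa using hr)
  obtain ⟨δ, hδ, hδball⟩ := Metric.eventually_nhds_iff.1 (h1.and h2)
  refine ⟨δ, hδ, fun d s hd hs hlt ↦ ?_⟩
  obtain ⟨hx1, hx2⟩ := hδball (y := s • d) (by simpa using hlt)
  have hdE := hφV d (hdirL d hd)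
  have hnonneg : 0 ≤ φ (s • d) := by
    rw [map_smul]
    exact mul_nonneg hs (hF.dual_nonneg hL hwF hp hr hball hφp hφE hd hdE)
  have hbase : w + (2 : ℝ) • (s • d - φ (s • d) • p) ∈ L :=
    hF.2.1 (hball _ (Submodule.smul_mem _ _ (hφV _ (Submodule.smul_mem _ s (hdirL d hd)))) hx2)
  have hapex : w + (2 * φ (s • d)) • p ∈ L :=
    hL.add_smul_mem hwL hp ⟨by linarith, by linarith⟩
  convert hL hbase hapex (a := 1 / 2) (b := 1 / 2) (by norm_num) (by norm_num) (by norm_num)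
    using 1
  generalize φ (s • d) = c
  module

/-- If the image of a bounded convex set is locally conical at `f v`, then the restricted linear
map is open at `v`. -/
theorem mapsOpenAt_of_locally_conical {X Y : Type*} [NormedAddCommGroup X] [NormedSpace ℝ X]
    [NormedAddCommGroup Y] [NormedSpace ℝ Y] {K : Set X} (hKb : Bornology.IsBounded K)
    (hK : Convex ℝ K) (f : X →ₗ[ℝ] Y) {v : X} (hv : v ∈ K)
    (hcone : ∃ δ > 0, ∀ d (s : ℝ), f v + d ∈ f '' K → 0 ≤ s → ‖s • d‖ < δ →
      f v + s • d ∈ f '' K) :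
    MapsOpenAt f K (f '' K) v := by
  intro N _ hN
  obtain ⟨δ, hδ, hcone⟩ := hcone
  obtain ⟨ε, hε, hεN⟩ := Metric.mem_nhdsWithin_iff.1 hN
  obtain ⟨R, hR, hKR⟩ := hKb.exists_pos_norm_le
  set t := min 1 (ε / (4 * R)) with ht
  have ht0 : 0 < t := by positivity
  have htR : t * (4 * R) ≤ ε := (le_div_iff₀ (by positivity)).1 (min_le_right _ _)
  refine Metric.mem_nhdsWithin_iff.2 ⟨t * δ, by positivity, ?_⟩
  rintro u ⟨hu, huL⟩
  rw [mem_ball_iff_norm] at hu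
  obtain ⟨x, hx, hfx⟩ := hcone (u - f v) t⁻¹ (by simpa using huL) (by positivity) (by
    rwa [norm_smul, norm_inv, Real.norm_of_nonneg ht0.le, inv_mul_lt_iff₀ ht0])
  refine ⟨v + t • (x - v), hεN ⟨?_, ?_⟩, ?_⟩
  · rw [mem_ball_iff_norm, add_sub_cancel_left, norm_smul, Real.norm_of_nonneg ht0.le]
    have := norm_sub_le x v
    nlinarith [hKR x hx, hKR v hv, mul_pos ht0 hR]
  · exact hK.add_smul_sub_mem hv hx ⟨ht0.le, min_le_left _ _⟩
  · rw [map_add, map_smul, map_sub, hfx, add_sub_cancel_left, smul_inv_smul₀ ht0.ne']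
    abel

theorem open_on_fibers_of_facet_relint {X Y : Type*}
    [NormedAddCommGroup X] [NormedSpace ℝ X] [FiniteDimensional ℝ X]
    [NormedAddCommGroup Y] [NormedSpace ℝ Y] [FiniteDimensional ℝ Y]
    (K : Set X) (hKne : K.Nonempty) (hKcomp : IsCompact K) (hKconv : Convex ℝ K)
    (f : X →ₗ[ℝ] Y) (L : Set Y) (hL : L = f '' K)
    (F : Set Y) (hF : IsFaceOf L F) (hfacet : convDim F + 1 = convDim L)
    (w : Y) (hw : w ∈ intrinsicInterior ℝ F) :
    ∀ v ∈ K, f v = w → MapsOpenAt f K L v := by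
  rintro v hv rfl
  subst hL
  exact mapsOpenAt_of_locally_conical hKcomp.isBounded hKconv f hv
    (hF.exists_pos_add_smul_mem (hKconv.linear_image f) hfacet hw)
end

section
/- Let w ∈ L and v ∈ f|_K^{-1}(w). If F is a face of K with v ∈ ri(F) and G is a face of L with w ∈ ri(G), then f(F) ⊆ G. -/
open Set Filter Topology

theorem exists_mem_openSegment_of_mem_intrinsicInterior {E : Type*}
    [NormedAddCommGroup E] [NormedSpace ℝ E] {s : Set E} {v x : E}
    (hv : v ∈ intrinsicInterior ℝ s) (hx : x ∈ s) : ∃ y ∈ s, v ∈ openSegment ℝ x y := by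
  obtain ⟨v', hv', rfl⟩ := mem_intrinsicInterior.1 hv
  let p : ℝ → affineSpan ℝ s := fun t =>
    ⟨AffineMap.lineMap x (v' : E) t,
      AffineMap.lineMap_mem t (subset_affineSpan ℝ s hx) v'.2⟩
  have hp : Continuous p := AffineMap.lineMap_continuous.subtype_mk _
  have hp1 : p 1 = v' := Subtype.ext (AffineMap.lineMap_apply_one _ _)
  have hev : ∀ᶠ t in 𝓝 (1 : ℝ), (p t : E) ∈ s :=
    hp.continuousAt.eventually (by rw [hp1]; exact mem_interior_iff_mem_nhds.1 hv')
  obtain ⟨t, hts, ht⟩ :=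
    ((hev.filter_mono nhdsWithin_le_nhds).and (self_mem_nhdsWithin (s := Ioi (1 : ℝ)))).exists
  have ht1 : 1 < t := ht
  have ht0 : 0 < t := one_pos.trans ht1
  refine ⟨p t, hts, ?_⟩
  rw [openSegment_eq_image_lineMap]
  refine ⟨t⁻¹, ⟨inv_pos.2 ht0, inv_lt_one_of_one_lt₀ ht1⟩, ?_⟩
  simp [p, AffineMap.lineMap_apply, smul_smul, inv_mul_cancel₀ ht0.ne']

theorem image_of_face_subset_face {X Y : Type*}
    [NormedAddCommGroup X] [NormedSpace ℝ X] [FiniteDimensional ℝ X]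
    [NormedAddCommGroup Y] [NormedSpace ℝ Y] [FiniteDimensional ℝ Y]
    (K : Set X) (hKne : K.Nonempty) (hKcomp : IsCompact K) (hKconv : Convex ℝ K)
    (f : X →ₗ[ℝ] Y) (L : Set Y) (hL : L = f '' K)
    (w : Y) (hw : w ∈ L) (v : X) (hv : v ∈ K) (hfv : f v = w)
    (F : Set X) (hF : IsFaceOf K F) (hvF : v ∈ intrinsicInterior ℝ F)
    (G : Set Y) (hG : IsFaceOf L G) (hwG : w ∈ intrinsicInterior ℝ G) :
    f '' F ⊆ G := by
  rintro _ ⟨x, hx, rfl⟩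
  obtain ⟨y, hy, hvy⟩ := exists_mem_openSegment_of_mem_intrinsicInterior hvF hx
  subst hL
  refine hG.2.left_mem_of_mem_openSegment (mem_image_of_mem f (hF.2.subset hx))
    (mem_image_of_mem f (hF.2.subset hy)) (intrinsicInterior_subset hwG) ?_
  rw [← hfv, ← LinearMap.coe_toAffineMap f, ← image_openSegment]
  exact mem_image_of_mem _ hvy
end

section
/- Assume K is stable. Let (w_i)_{i∈ℕ} ⊆ L converge to w ∈ L, and let (v_i)_{i∈ℕ} ⊆ K converge to v ∈ K with f(v_i) = w_i for all i and v ∈ ri(f|_K^{-1}(w)). Let G be the face of L with w ∈ ri(G) and for each i let G_i be the face of L with w_i ∈ ri(G_i). Then dim(G) ≤ liminf_{i→∞} dim(G_i). -/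
open Set Filter Topology

/-- A convex body `K` is stable if the midpoint map `K × K → K` is open
(with respect to the subspace topologies). -/
def IsStableConvexBody {X : Type*} [NormedAddCommGroup X] [NormedSpace ℝ X] (K : Set X) : Prop :=
  ∀ p ∈ K ×ˢ K, ∀ N ⊆ K ×ˢ K, N ∈ nhdsWithin p (K ×ˢ K) →
    (fun q : X × X => midpoint ℝ q.1 q.2) '' N ∈ nhdsWithin (midpoint ℝ p.1 p.2) K

/-- A point of the intrinsic interior of `C` stays in `C` when pushed slightly away from any point
of `C`. -/
theorem exists_pos_add_smul_sub_mem_of_mem_intrinsicInterior {E : Type*}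
    [NormedAddCommGroup E] [NormedSpace ℝ E] {C : Set E} {x y : E}
    (hx : x ∈ intrinsicInterior ℝ C) (hy : y ∈ C) :
    ∃ ε : ℝ, 0 < ε ∧ x + ε • (x - y) ∈ C := by
  obtain ⟨x, hxi, rfl⟩ := mem_intrinsicInterior.1 hx
  let γ : ℝ → affineSpan ℝ C := fun t =>
    ⟨AffineMap.lineMap (x : E) y (-t),
      AffineMap.lineMap_mem _ x.2 (subset_affineSpan ℝ C hy)⟩
  have hγ : Continuous γ := by
    refine Continuous.subtype_mk ?_ _
    exact AffineMap.lineMap_continuous.comp continuous_neg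
  have hγ0 : γ 0 = x := Subtype.ext (by simp [γ])
  have hmem : ∀ᶠ t in 𝓝 (0 : ℝ), (γ t : E) ∈ C := by
    have := hγ.continuousAt.preimage_mem_nhds
      (by rw [hγ0]; exact mem_interior_iff_mem_nhds.1 hxi :
        ((↑) ⁻¹' C : Set (affineSpan ℝ C)) ∈ 𝓝 (γ 0))
    exact this
  obtain ⟨t, htC, ht⟩ :=
    ((hmem.filter_mono nhdsWithin_le_nhds).and (self_mem_nhdsWithin (s := Ioi (0 : ℝ)))).exists
  refine ⟨t, ht, ?_⟩
  convert htC using 1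
  simp only [γ, AffineMap.lineMap_apply, vsub_eq_sub, vadd_eq_add]
  module

/-- If `v` lies in the relative interior of a fiber over a relative interior point of `G ⊆ f '' K`,
then every direction of `G` lifts, up to scaling, to a symmetric segment in `K` centered at `v`. -/
theorem exists_symmetric_lift {X Y : Type*}
    [NormedAddCommGroup X] [NormedSpace ℝ X] [NormedAddCommGroup Y] [NormedSpace ℝ Y]
    {K : Set X} (hK : Convex ℝ K) (f : X →ₗ[ℝ] Y) {v : X} {w : Y}
    (hv : v ∈ intrinsicInterior ℝ {x ∈ K | f x = w})
    {G : Set Y} (hGK : G ⊆ f '' K) (hw : w ∈ intrinsicInterior ℝ G) {g : Y} (hg : g ∈ G) :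
    ∃ u : X, ∃ c : ℝ, 0 < c ∧ v + u ∈ K ∧ v - u ∈ K ∧ f u = c • (g - w) := by
  obtain ⟨hvK, hfv⟩ := intrinsicInterior_subset hv
  obtain ⟨δ, hδ, hδG⟩ := exists_pos_add_smul_sub_mem_of_mem_intrinsicInterior hw hg
  obtain ⟨x, hxK, rfl⟩ := hGK hg
  obtain ⟨x', hx'K, hfx'⟩ := hGK hδG
  have hδ' : 1 + δ ≠ 0 := by positivity
  have hu₀ : (δ / (1 + δ)) • x + (1 / (1 + δ)) • x' ∈ {x ∈ K | f x = w} := by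
    refine ⟨hK hxK hx'K (by positivity) (by positivity) (by field_simp; ring), ?_⟩
    rw [map_add, map_smul, map_smul, hfx']
    match_scalars <;> field_simp
    ring
  obtain ⟨η, hη, hu'K, -⟩ := exists_pos_add_smul_sub_mem_of_mem_intrinsicInterior hv hu₀
  have hη' : 1 + η ≠ 0 := by positivity
  set u' := v + η • (v - ((δ / (1 + δ)) • x + (1 / (1 + δ)) • x')) with hu'
  set c := η * δ / ((1 + η) * (1 + δ)) with hc
  have hc0 : 0 < c := by positivity
  have hc1 : c ≤ 1 := by
    rw [hc, div_le_one (by positivity)]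
    nlinarith
  refine ⟨c • (x - v), c, hc0, hK.add_smul_sub_mem hvK hxK ⟨hc0.le, hc1⟩, ?_, ?_⟩
  · have hmem := hK.sum_mem (t := Finset.univ)
      (w := ![c, 1 / (1 + η), η / ((1 + η) * (1 + δ))]) (z := ![v, u', x'])
      (by intro i _; fin_cases i <;> simp <;> positivity)
      (by simp only [Fin.sum_univ_three, Matrix.cons_val]; rw [hc]; field_simp; ring)
      (by intro i _; fin_cases i <;> simpa)
    convert hmem using 1
    simp only [Fin.sum_univ_three, Matrix.cons_val, hu', hc]
    match_scalars <;> field_simp <;> ring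
  · rw [map_smul, map_sub, hfv]

/-- In a stable convex body, a decomposition of a limit point as a midpoint lifts approximately to
the points of the sequence. -/
theorem IsStableConvexBody.eventually_exists_midpoint_eq {X ι : Type*}
    [NormedAddCommGroup X] [NormedSpace ℝ X] {K : Set X} (hK : IsStableConvexBody K)
    {l : Filter ι} {v : ι → X} (hv : ∀ i, v i ∈ K) {a b : X} (ha : a ∈ K) (hb : b ∈ K)
    (hlim : Tendsto v l (𝓝 (midpoint ℝ a b))) {U : Set X} (hU : U ∈ 𝓝 a) :
    ∀ᶠ i in l, ∃ a' ∈ U ∩ K, ∃ b' ∈ K, midpoint ℝ a' b' = v i := by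
  have hN : (U ×ˢ univ) ∩ K ×ˢ K ∈ 𝓝[K ×ˢ K] (a, b) :=
    inter_mem (mem_nhdsWithin_of_mem_nhds (prod_mem_nhds hU univ_mem)) self_mem_nhdsWithin
  have himage := hK (a, b) ⟨ha, hb⟩ _ inter_subset_right hN
  filter_upwards [(tendsto_nhdsWithin_iff.2 ⟨hlim, .of_forall hv⟩) himage] with i hi
  obtain ⟨⟨a', b'⟩, ⟨⟨ha'U, -⟩, ha', hb'⟩, h⟩ := hi
  exact ⟨a', ⟨ha'U, ha'⟩, b', hb', h⟩

theorem card_le_convDim_of_linearIndependent {E ι : Type*} [Fintype ι]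
    [NormedAddCommGroup E] [NormedSpace ℝ E] [FiniteDimensional ℝ E] {C : Set E} {p : E}
    (hp : p ∈ C) {z : ι → E} (hz : ∀ j, z j ∈ C)
    (hli : LinearIndependent ℝ fun j => z j - p) : Fintype.card ι ≤ convDim C := by
  rw [convDim, direction_affineSpan]
  let y : ι → vectorSpan ℝ C := fun j => ⟨z j - p, vsub_mem_vectorSpan ℝ (hz j) hp⟩
  have hy : LinearIndependent ℝ y := LinearIndependent.of_comp (vectorSpan ℝ C).subtype hli
  exact hy.fintype_card_le_finrank

theorem exists_linearIndependent_sub_of_convDim {E : Type*}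
    [NormedAddCommGroup E] [NormedSpace ℝ E] [FiniteDimensional ℝ E] {C : Set E} {p : E}
    (hp : p ∈ C) :
    ∃ g : Fin (convDim C) → E, (∀ j, g j ∈ C) ∧ LinearIndependent ℝ fun j => g j - p := by
  rw [convDim, direction_affineSpan, vectorSpan_eq_span_vsub_set_right ℝ hp]
  obtain ⟨h, hmem, -, hli⟩ := Submodule.exists_fun_fin_finrank_span_eq ℝ ((· -ᵥ p) '' C)
  choose g hg hgh using hmem
  refine ⟨g, hg, ?_⟩
  rwa [show (fun j => g j - p) = h from funext hgh]

theorem face_dim_lsc_along_sequence {X Y : Type*}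
    [NormedAddCommGroup X] [NormedSpace ℝ X] [FiniteDimensional ℝ X]
    [NormedAddCommGroup Y] [NormedSpace ℝ Y] [FiniteDimensional ℝ Y]
    (K : Set X) (hKne : K.Nonempty) (hKcomp : IsCompact K) (hKconv : Convex ℝ K)
    (hstable : IsStableConvexBody K)
    (f : X →ₗ[ℝ] Y) (L : Set Y) (hL : L = f '' K)
    (w : ℕ → Y) (wlim : Y) (hwL : ∀ i, w i ∈ L) (hwlimL : wlim ∈ L)
    (hwconv : Tendsto w atTop (nhds wlim))
    (v : ℕ → X) (vlim : X) (hvK : ∀ i, v i ∈ K) (hfv : ∀ i, f (v i) = w i)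
    (hvconv : Tendsto v atTop (nhds vlim))
    (hvlim : vlim ∈ intrinsicInterior ℝ {x ∈ K | f x = wlim})
    (G : Set Y) (hG : IsFaceOf L G) (hwG : wlim ∈ intrinsicInterior ℝ G)
    (Gi : ℕ → Set Y) (hGi : ∀ i, IsFaceOf L (Gi i)) (hwGi : ∀ i, w i ∈ intrinsicInterior ℝ (Gi i)) :
    convDim G ≤ Filter.liminf (fun i => convDim (Gi i)) Filter.atTop := by
  subst hL
  have hbdd : IsCoboundedUnder (· ≥ ·) atTop fun i => convDim (Gi i) :=
    (isBoundedUnder_of ⟨Module.finrank ℝ Y, fun i => Submodule.finrank_le _⟩ :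
      IsBoundedUnder (· ≤ ·) atTop fun i => convDim (Gi i)).isCoboundedUnder_ge
  refine le_liminf_of_le hbdd ?_
  obtain ⟨g, hgG, hgli⟩ := exists_linearIndependent_sub_of_convDim (intrinsicInterior_subset hwG)
  choose u c hc hadd hsub hfu using fun j =>
    exists_symmetric_lift hKconv f hvlim hG.2.1 hwG (hgG j)
  have huli : LinearIndependent ℝ fun j => f (u j) := by
    convert hgli.units_smul fun j => Units.mk0 (c j) (hc j).ne' using 2 with j
    exact hfu j
  obtain ⟨r, hr, hball⟩ := Metric.isOpen_iff.1
    (isOpen_setOfPred_linearIndependent (𝕜 := ℝ) (E := Y) (ι := Fin (convDim G))) _ huli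
  have hfvlim : f vlim = wlim := (intrinsicInterior_subset hvlim).2
  have hlift : ∀ j, ∀ᶠ i in atTop,
      ∃ a ∈ (f ⁻¹' Metric.ball (f (vlim + u j)) (r / 2)) ∩ K, ∃ b ∈ K, midpoint ℝ a b = v i := by
    intro j
    refine hstable.eventually_exists_midpoint_eq hvK (hadd j) (hsub j) ?_
      (f.continuous_of_finiteDimensional.continuousAt.preimage_mem_nhds
        (Metric.ball_mem_nhds _ (half_pos hr)))
    simpa using hvconv
  filter_upwards [eventually_all.2 hlift, Metric.tendsto_nhds.1 hwconv _ (half_pos hr)]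
    with i hi hwi
  choose a ha b hb hab using hi
  have hwiG : w i ∈ Gi i := intrinsicInterior_subset (hwGi i)
  have hfa : ∀ j, f (a j) ∈ Gi i := by
    intro j
    refine (hGi i).2.2 (mem_image_of_mem f (ha j).2) (mem_image_of_mem f (hb j)) hwiG ?_
    rw [← hfv i, ← hab j]
    exact (f.toAffineMap.map_midpoint (a j) (b j)) ▸ midpoint_mem_openSegment (f (a j)) (f (b j))
  have hli : LinearIndependent ℝ fun j => f (a j) - w i := by
    refine hball ((dist_pi_lt_iff hr).2 fun j => ?_)
    have hsub_eq : f (u j) = f (vlim + u j) - wlim := by rw [map_add, hfvlim]; abel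
    rw [hsub_eq]
    linarith [dist_sub_sub_le (f (a j)) (w i) (f (vlim + u j)) wlim, Metric.mem_ball.1 (ha j).1]
  simpa using card_le_convDim_of_linearIndependent hwiG hfa hli
end

section
/- Let u_1, u_2 ∈ M_d be hermitian and suppose W(u_1,u_2) has dimension two. Then every corner point of W(u_1,u_2) lies in two distinct one-dimensional faces (facets) of W(u_1,u_2). -/
open Set Filter Topology Matrix
open scoped ComplexOrder

/-- The joint numerical range `W(u₁,u₂) ⊆ ℝ²` of two (hermitian) matrices. -/
def jointNR {d : ℕ} (u₁ u₂ : Matrix (Fin d) (Fin d) ℂ) : Set (ℝ × ℝ) :=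
  {p | ∃ x : Fin d → ℂ, star x ⬝ᵥ x = 1 ∧
    p = ((star x ⬝ᵥ u₁.mulVec x).re, (star x ⬝ᵥ u₂.mulVec x).re)}

/-- The state space `𝓜_d`: positive semidefinite matrices of trace one. -/
def stateSpace (d : ℕ) : Set (Matrix (Fin d) (Fin d) ℂ) :=
  {ρ | ρ.PosSemidef ∧ ρ.trace = 1}

/-- The expected value map `ρ ↦ (tr(u₁ρ), tr(u₂ρ))` (real for hermitian arguments). -/
noncomputable def expVal2 {d : ℕ} (u₁ u₂ : Matrix (Fin d) (Fin d) ℂ)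
    (ρ : Matrix (Fin d) (Fin d) ℂ) : ℝ × ℝ :=
  ((u₁ * ρ).trace.re, (u₂ * ρ).trace.re)

/-- A supporting line of `C` at `p`: the level set of a nonzero linear functional attaining
its maximum over `C` at `p`. -/
def IsSupportingLineAt (C : Set (ℝ × ℝ)) (p : ℝ × ℝ) (l : Set (ℝ × ℝ)) : Prop :=
  ∃ (φ : (ℝ × ℝ) →ₗ[ℝ] ℝ) (c : ℝ), φ ≠ 0 ∧ l = {q | φ q = c} ∧ φ p = c ∧ ∀ q ∈ C, φ q ≤ c

/-- A corner point of `C`: a point of `C` lying on more than one supporting line. -/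
def IsCornerPoint (C : Set (ℝ × ℝ)) (p : ℝ × ℝ) : Prop :=
  p ∈ C ∧ ∃ l₁ l₂ : Set (ℝ × ℝ), l₁ ≠ l₂ ∧ IsSupportingLineAt C p l₁ ∧ IsSupportingLineAt C p l₂

/-- A round boundary point of `C`: a boundary point which is neither a corner point nor lies
in the relative interior of a flat boundary portion (a nondegenerate segment in the boundary). -/
def IsRoundBoundaryPoint (C : Set (ℝ × ℝ)) (p : ℝ × ℝ) : Prop :=
  p ∈ frontier C ∧ ¬ IsCornerPoint C p ∧
    ¬ ∃ a b : ℝ × ℝ, a ≠ b ∧ segment ℝ a b ⊆ frontier C ∧ p ∈ openSegment ℝ a b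

/-- `z` is singularly generated if all unit vectors generating it are proportional. -/
def SinglyGenerated {d : ℕ} (u₁ u₂ : Matrix (Fin d) (Fin d) ℂ) (z : ℝ × ℝ) : Prop :=
  ∀ x y : Fin d → ℂ, star x ⬝ᵥ x = 1 → star y ⬝ᵥ y = 1 →
    ((star x ⬝ᵥ u₁.mulVec x).re, (star x ⬝ᵥ u₂.mulVec x).re) = z →
    ((star y ⬝ᵥ u₁.mulVec y).re, (star y ⬝ᵥ u₂.mulVec y).re) = z →
    ∃ c : ℂ, y = c • x

/-- `z` is multiply generated if it lies in the joint numerical range but is not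
singularly generated. -/
def MultiplyGenerated {d : ℕ} (u₁ u₂ : Matrix (Fin d) (Fin d) ℂ) (z : ℝ × ℝ) : Prop :=
  z ∈ jointNR u₁ u₂ ∧ ¬ SinglyGenerated u₁ u₂ z

/-- A matrix is unitarily reducible if it is unitarily equivalent to a block diagonal matrix
with (at least) two proper diagonal blocks. -/
def UnitarilyReducible {d : ℕ} (A : Matrix (Fin d) (Fin d) ℂ) : Prop :=
  ∃ (a b : ℕ) (hab : a + b = d), 0 < a ∧ 0 < b ∧
    ∃ U ∈ Matrix.unitaryGroup (Fin d) ℂ,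
      ∃ (B : Matrix (Fin a) (Fin a) ℂ) (C : Matrix (Fin b) (Fin b) ℂ),
        star U * A * U =
          Matrix.reindex (finSumFinEquiv.trans (finCongr hab))
            (finSumFinEquiv.trans (finCongr hab)) (Matrix.fromBlocks B 0 0 C)

/-! ### Linear functionals and lines in the plane -/

/-- The linear functional `q ↦ a * q.1 + b * q.2` on the plane. -/
noncomputable def planeFunctional (a b : ℝ) : (ℝ × ℝ) →ₗ[ℝ] ℝ :=
  a • LinearMap.fst ℝ ℝ ℝ + b • LinearMap.snd ℝ ℝ ℝ

@[simp]
theorem planeFunctional_apply (a b : ℝ) (q : ℝ × ℝ) :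
    planeFunctional a b q = a * q.1 + b * q.2 := by
  simp [planeFunctional]

theorem eq_planeFunctional (φ : (ℝ × ℝ) →ₗ[ℝ] ℝ) : φ = planeFunctional (φ (1, 0)) (φ (0, 1)) := by
  ext <;> simp

theorem planeFunctional_ne_zero {a b : ℝ} (h : a ≠ 0 ∨ b ≠ 0) : planeFunctional a b ≠ 0 := by
  intro h0
  rcases h with h | h
  · exact h (by simpa using LinearMap.congr_fun h0 (1, 0))
  · exact h (by simpa using LinearMap.congr_fun h0 (0, 1))

theorem coeff_ne_zero_of_planeFunctional_ne_zero {a b : ℝ} (h : planeFunctional a b ≠ 0) :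
    a ≠ 0 ∨ b ≠ 0 := by
  by_contra! h0
  exact h (by ext <;> simp [h0])

theorem planeFunctional_eq_zero_of_det_eq_zero {a₁ b₁ a₂ b₂ : ℝ} (h : a₁ ≠ 0 ∨ b₁ ≠ 0)
    (hD : a₁ * b₂ - a₂ * b₁ = 0) {q : ℝ × ℝ} (hq : planeFunctional a₁ b₁ q = 0) :
    planeFunctional a₂ b₂ q = 0 := by
  rw [planeFunctional_apply] at *
  rcases h with h | h
  · refine (mul_eq_zero.1 (?_ : a₁ * _ = 0)).resolve_left h
    linear_combination a₂ * hq + q.2 * hD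
  · refine (mul_eq_zero.1 (?_ : b₁ * _ = 0)).resolve_left h
    linear_combination b₂ * hq - q.1 * hD

theorem eq_zero_of_planeFunctional_eq_zero {a₁ b₁ a₂ b₂ : ℝ} (hD : a₁ * b₂ - a₂ * b₁ ≠ 0)
    {q : ℝ × ℝ} (h₁ : planeFunctional a₁ b₁ q = 0) (h₂ : planeFunctional a₂ b₂ q = 0) : q = 0 := by
  rw [planeFunctional_apply] at *
  have e₁ : q.1 = 0 := by
    refine (mul_eq_zero.1 (?_ : (a₁ * b₂ - a₂ * b₁) * _ = 0)).resolve_left hD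
    linear_combination b₂ * h₁ - b₁ * h₂
  have e₂ : q.2 = 0 := by
    refine (mul_eq_zero.1 (?_ : (a₁ * b₂ - a₂ * b₁) * _ = 0)).resolve_left hD
    linear_combination a₁ * h₂ - a₂ * h₁
  exact Prod.ext e₁ e₂

theorem finrank_ker_of_ne_zero {φ : (ℝ × ℝ) →ₗ[ℝ] ℝ} (hφ : φ ≠ 0) :
    Module.finrank ℝ (LinearMap.ker φ) = 1 := by
  have h := Module.Dual.finrank_ker_add_one_of_ne_zero (f := φ) hφ
  rw [Module.finrank_prod, Module.finrank_self] at h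
  omega

theorem vectorSpan_le_ker {C : Set (ℝ × ℝ)} {φ : (ℝ × ℝ) →ₗ[ℝ] ℝ} {c : ℝ}
    (hC : ∀ q ∈ C, φ q = c) : vectorSpan ℝ C ≤ LinearMap.ker φ := by
  rw [vectorSpan_def, Submodule.span_le]
  rintro _ ⟨x, hx, y, hy, rfl⟩
  simp [hC x hx, hC y hy]

theorem convDim_le_one {C : Set (ℝ × ℝ)} {φ : (ℝ × ℝ) →ₗ[ℝ] ℝ} (hφ : φ ≠ 0) {c : ℝ}
    (hC : ∀ q ∈ C, φ q = c) : convDim C ≤ 1 := by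
  rw [convDim, direction_affineSpan, ← finrank_ker_of_ne_zero hφ]
  exact Submodule.finrank_mono (vectorSpan_le_ker hC)

theorem convDim_pos {C : Set (ℝ × ℝ)} {p q : ℝ × ℝ} (hp : p ∈ C) (hq : q ∈ C) (hpq : p ≠ q) :
    0 < convDim C := by
  rw [convDim, direction_affineSpan, Module.finrank_pos_iff_exists_ne_zero]
  exact ⟨⟨p - q, vsub_mem_vectorSpan ℝ hp hq⟩, by simpa [Subtype.ext_iff, sub_eq_zero] using hpq⟩

theorem IsPreconnected.convex_of_subset_line {C : Set (ℝ × ℝ)} (hconn : IsPreconnected C)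
    {a b : ℝ} (hab : a ≠ 0 ∨ b ≠ 0) {c : ℝ} (hC : ∀ q ∈ C, planeFunctional a b q = c) :
    Convex ℝ C := by
  have hD : a * a - (-b) * b ≠ 0 := by
    rcases hab with h | h
    · have := sq_pos_of_ne_zero h
      nlinarith [sq_nonneg b]
    · have := sq_pos_of_ne_zero h
      nlinarith [sq_nonneg a]
  have hcont : Continuous (planeFunctional (-b) a) := LinearMap.continuous_of_finiteDimensional _
  have himg : Convex ℝ (planeFunctional (-b) a '' C) :=
    (hconn.image _ hcont.continuousOn).ordConnected.convex
  intro x hx y hy s t hs ht hst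
  obtain ⟨z, hz, hzeq⟩ := himg ⟨x, hx, rfl⟩ ⟨y, hy, rfl⟩ hs ht hst
  have hsub : z - (s • x + t • y) = 0 := by
    refine eq_zero_of_planeFunctional_eq_zero hD ?_ ?_
    · rw [map_sub, map_add, map_smul, map_smul, hC z hz, hC x hx, hC y hy, smul_eq_mul,
        smul_eq_mul]
      linear_combination -c * hst
    · rw [map_sub, map_add, map_smul, map_smul, hzeq, sub_self]
  rwa [← sub_eq_zero.1 hsub]

theorem isExtreme_inter_of_forall_le {C : Set (ℝ × ℝ)} {φ : (ℝ × ℝ) →ₗ[ℝ] ℝ} {c : ℝ}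
    (hC : ∀ q ∈ C, φ q ≤ c) : IsExtreme ℝ C {q ∈ C | φ q = c} := by
  refine ⟨fun q hq => hq.1, ?_⟩
  rintro x hx y hy _ ⟨-, hz⟩ ⟨s, t, hs, ht, hst, rfl⟩
  refine ⟨hx, le_antisymm (hC x hx) ?_⟩
  have hy' := mul_le_mul_of_nonneg_left (hC y hy) ht.le
  rw [map_add, map_smul, map_smul, smul_eq_mul, smul_eq_mul] at hz
  have ht' : t = 1 - s := by linarith
  subst ht'
  exact le_of_mul_le_mul_left (by linarith) hs

/-! ### Quadratic forms of symmetric operators -/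

section QuadraticForm

variable {E : Type*} [NormedAddCommGroup E] [InnerProductSpace ℂ E]

/-- The pair of quadratic forms of two operators. -/
noncomputable def quadPair (S₁ S₂ : E →ₗ[ℂ] E) (x : E) : ℝ × ℝ :=
  ((inner ℂ x (S₁ x)).re, (inner ℂ x (S₂ x)).re)

theorem planeFunctional_quadPair (S₁ S₂ : E →ₗ[ℂ] E) (a b : ℝ) (x : E) :
    planeFunctional a b (quadPair S₁ S₂ x) =
      (inner ℂ x (((a : ℂ) • S₁ + (b : ℂ) • S₂) x)).re := by
  simp [quadPair]

theorem quadPair_smul (S₁ S₂ : E →ₗ[ℂ] E) (r : ℝ) (x : E) :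
    quadPair S₁ S₂ ((r : ℂ) • x) = (r ^ 2) • quadPair S₁ S₂ x := by
  ext <;> simp [quadPair] <;> ring

theorem quadPair_add_of_mem_ker {S₁ S₂ : E →ₗ[ℂ] E} (h₁ : S₁.IsSymmetric) (h₂ : S₂.IsSymmetric)
    {v w : E} (hv₁ : S₁ v = 0) (hv₂ : S₂ v = 0) :
    quadPair S₁ S₂ (v + w) = quadPair S₁ S₂ w := by
  simp [quadPair, hv₁, hv₂, ← h₁ v w, ← h₂ v w]

theorem continuous_quadPair [FiniteDimensional ℂ E] (S₁ S₂ : E →ₗ[ℂ] E) :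
    Continuous (quadPair S₁ S₂) := by
  have c₁ : Continuous S₁ := S₁.continuous_of_finiteDimensional
  have c₂ : Continuous S₂ := S₂.continuous_of_finiteDimensional
  unfold quadPair
  exact (Complex.continuous_re.comp (continuous_id.inner c₁)).prodMk
    (Complex.continuous_re.comp (continuous_id.inner c₂))

theorem LinearMap.IsSymmetric.real_comb {S₁ S₂ : E →ₗ[ℂ] E} (h₁ : S₁.IsSymmetric)
    (h₂ : S₂.IsSymmetric) (a b : ℝ) : ((a : ℂ) • S₁ + (b : ℂ) • S₂).IsSymmetric := by
  intro x y
  simp only [LinearMap.add_apply, LinearMap.smul_apply, inner_add_left, inner_add_right,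
    inner_smul_left, inner_smul_right, Complex.conj_ofReal, h₁ x y, h₂ x y]

theorem LinearMap.IsSymmetric.apply_eq_zero_of_forall_nonpos {S : E →ₗ[ℂ] E} (hS : S.IsSymmetric)
    (hneg : ∀ x, (inner ℂ x (S x)).re ≤ 0) {x : E} (hx : (inner ℂ x (S x)).re = 0) : S x = 0 := by
  set n : ℝ := ‖S x‖ ^ 2 with hn
  set c : ℝ := (inner ℂ (S x) (S (S x))).re with hc
  have hself : (inner ℂ (S x) (S x)).re = n := by
    rw [inner_self_eq_norm_sq_to_K]
    norm_cast
  have key : ∀ t : ℝ, 2 * t * n + t ^ 2 * c ≤ 0 := by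
    intro t
    have h := hneg (x + (t : ℂ) • S x)
    simp only [map_add, map_smul, inner_add_left, inner_add_right, inner_smul_left,
      inner_smul_right, Complex.add_re, Complex.conj_ofReal, Complex.re_ofReal_mul, ← hS x (S x),
      hself, hx, ← hc] at h
    linarith
  have hc0 : c ≤ 0 := hneg (S x)
  have hn0 : 0 ≤ n := by positivity
  have hk := key (n / (1 - c))
  have hpos : 0 < 1 - c := by linarith
  have heq : 2 * (n / (1 - c)) * n + (n / (1 - c)) ^ 2 * c = n ^ 2 * (2 - c) / (1 - c) ^ 2 := by
    field_simp
    ring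
  rw [heq, div_nonpos_iff] at hk
  have hn2 : n = 0 := by
    have : 0 < (1 - c) ^ 2 := by positivity
    rcases hk with h | h
    · linarith
    · nlinarith [h.1, sq_nonneg n]
  rw [hn] at hn2
  exact norm_eq_zero.1 (pow_eq_zero_iff two_ne_zero |>.1 hn2)

theorem isPreconnected_unit_sphere_of_complex (F : Type*) [NormedAddCommGroup F]
    [NormedSpace ℂ F] [FiniteDimensional ℂ F] : IsPreconnected (Metric.sphere (0 : F) 1) := by
  rcases subsingleton_or_nontrivial F with h | h
  · exact (Set.subsingleton_of_subsingleton).isPreconnected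
  · refine isPreconnected_sphere ?_ 0 1
    have : FiniteDimensional ℝ F := FiniteDimensional.complexToReal F
    rw [← Module.finrank_eq_rank, finrank_real_of_complex]
    have := Module.finrank_pos (R := ℂ) (M := F)
    exact_mod_cast (by omega : 1 < 2 * Module.finrank ℂ F)

theorem isPreconnected_unit_sphere_inter_submodule [FiniteDimensional ℂ E] (K : Submodule ℂ E) :
    IsPreconnected {x : E | ‖x‖ = 1 ∧ x ∈ K} := by
  have h := (isPreconnected_unit_sphere_of_complex K).image _ continuous_subtype_val.continuousOn
  convert h using 1
  ext x
  constructor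
  · rintro ⟨hx, hK⟩
    exact ⟨⟨x, hK⟩, by simpa using hx, rfl⟩
  · rintro ⟨y, hy, rfl⟩
    exact ⟨by simpa using hy, y.2⟩

/-- The level set of a functional bounding a numerical range is convex. -/
theorem convex_quadPair_level [FiniteDimensional ℂ E] {S₁ S₂ : E →ₗ[ℂ] E} (h₁ : S₁.IsSymmetric)
    (h₂ : S₂.IsSymmetric) {a b : ℝ} (hab : a ≠ 0 ∨ b ≠ 0)
    (hneg : ∀ x, planeFunctional a b (quadPair S₁ S₂ x) ≤ 0) (p : ℝ × ℝ) :
    Convex ℝ ((fun x => p + quadPair S₁ S₂ x) ''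
      {x | ‖x‖ = 1 ∧ planeFunctional a b (quadPair S₁ S₂ x) = 0}) := by
  have hset : {x | ‖x‖ = 1 ∧ planeFunctional a b (quadPair S₁ S₂ x) = 0} =
      {x | ‖x‖ = 1 ∧ x ∈ LinearMap.ker ((a : ℂ) • S₁ + (b : ℂ) • S₂)} := by
    ext x
    refine and_congr_right fun _ => ?_
    simp only [planeFunctional_quadPair] at hneg ⊢
    refine ⟨(h₁.real_comb h₂ a b).apply_eq_zero_of_forall_nonpos hneg, fun h => ?_⟩
    rw [LinearMap.mem_ker.1 h, inner_zero_right, Complex.zero_re]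
  have hconn := isPreconnected_unit_sphere_inter_submodule
    (LinearMap.ker ((a : ℂ) • S₁ + (b : ℂ) • S₂))
  rw [← hset] at hconn
  refine (hconn.image _ (continuous_const.add
    (continuous_quadPair S₁ S₂)).continuousOn).convex_of_subset_line hab
    (c := planeFunctional a b p) ?_
  rintro _ ⟨x, ⟨-, hx⟩, rfl⟩
  rw [Pi.add_apply, map_add, hx, add_zero]

theorem isFaceOf_supporting_level [FiniteDimensional ℂ E] {S₁ S₂ : E →ₗ[ℂ] E}
    (h₁ : S₁.IsSymmetric) (h₂ : S₂.IsSymmetric) {C : Set (ℝ × ℝ)} {p : ℝ × ℝ}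
    (hC : C = (fun x => p + quadPair S₁ S₂ x) '' {x | ‖x‖ = 1}) {a b : ℝ} (hab : a ≠ 0 ∨ b ≠ 0)
    (hneg : ∀ x, planeFunctional a b (quadPair S₁ S₂ x) ≤ 0) :
    IsFaceOf C {q ∈ C | planeFunctional a b q = planeFunctional a b p} := by
  refine ⟨?_, isExtreme_inter_of_forall_le ?_⟩
  · suffices h : {q ∈ C | planeFunctional a b q = planeFunctional a b p} =
        (fun x => p + quadPair S₁ S₂ x) ''
          {x | ‖x‖ = 1 ∧ planeFunctional a b (quadPair S₁ S₂ x) = 0} from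
      h ▸ convex_quadPair_level h₁ h₂ hab hneg p
    subst hC
    ext q
    constructor
    · rintro ⟨⟨x, hx, rfl⟩, hq⟩
      exact ⟨x, ⟨hx, by simpa only [map_add, add_eq_left] using hq⟩, rfl⟩
    · rintro ⟨x, ⟨hx, hq⟩, rfl⟩
      exact ⟨⟨x, hx, rfl⟩, by simpa only [map_add, add_eq_left] using hq⟩
  · subst hC
    rintro _ ⟨x, -, rfl⟩
    rw [map_add]
    linarith [hneg x]

/-- Two independent nonpositive combinations of the quadratic forms admit extremal slopes. -/
theorem exists_extremal_functionals [FiniteDimensional ℂ E] {S₁ S₂ : E →ₗ[ℂ] E}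
    (h₁ : S₁.IsSymmetric) (h₂ : S₂.IsSymmetric) {a₁ b₁ a₂ b₂ : ℝ}
    (hD : a₁ * b₂ - a₂ * b₁ ≠ 0)
    (hneg₁ : ∀ x, planeFunctional a₁ b₁ (quadPair S₁ S₂ x) ≤ 0)
    (hneg₂ : ∀ x, planeFunctional a₂ b₂ (quadPair S₁ S₂ x) ≤ 0)
    (hne : ∃ x, quadPair S₁ S₂ x ≠ 0) :
    ∃ m M : ℝ,
      (∀ x, planeFunctional a₁ b₁ (quadPair S₁ S₂ x) ≤
        m * planeFunctional (a₁ + a₂) (b₁ + b₂) (quadPair S₁ S₂ x)) ∧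
      (∀ x, M * planeFunctional (a₁ + a₂) (b₁ + b₂) (quadPair S₁ S₂ x) ≤
        planeFunctional a₁ b₁ (quadPair S₁ S₂ x)) ∧
      (∃ x, ‖x‖ = 1 ∧ quadPair S₁ S₂ x ≠ 0 ∧ planeFunctional a₁ b₁ (quadPair S₁ S₂ x) =
        m * planeFunctional (a₁ + a₂) (b₁ + b₂) (quadPair S₁ S₂ x)) ∧
      (∃ x, ‖x‖ = 1 ∧ quadPair S₁ S₂ x ≠ 0 ∧ planeFunctional a₁ b₁ (quadPair S₁ S₂ x) =
        M * planeFunctional (a₁ + a₂) (b₁ + b₂) (quadPair S₁ S₂ x)) := by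
  set V : Submodule ℂ E := LinearMap.ker S₁ ⊓ LinearMap.ker S₂ with hV
  set N : E → ℝ := fun x => planeFunctional a₁ b₁ (quadPair S₁ S₂ x) with hN
  set P : E → ℝ := fun x => planeFunctional (a₁ + a₂) (b₁ + b₂) (quadPair S₁ S₂ x) with hP
  have hPsum : ∀ x, P x = N x + planeFunctional a₂ b₂ (quadPair S₁ S₂ x) := by
    intro x
    simp only [hP, hN, planeFunctional_apply]
    ring
  have hzeroV : ∀ x, P x = 0 → x ∈ V := by
    intro x hx
    have e := hPsum x
    have e₁ : N x = 0 := by linarith [hneg₁ x, hneg₂ x]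
    have e₂ : planeFunctional a₂ b₂ (quadPair S₁ S₂ x) = 0 := by linarith
    simp only [hN, planeFunctional_quadPair] at e₁ e₂ hneg₁ hneg₂
    have k₁ := (h₁.real_comb h₂ a₁ b₁).apply_eq_zero_of_forall_nonpos hneg₁ e₁
    have k₂ := (h₁.real_comb h₂ a₂ b₂).apply_eq_zero_of_forall_nonpos hneg₂ e₂
    simp only [LinearMap.add_apply, LinearMap.smul_apply] at k₁ k₂
    have hDC : ((a₁ * b₂ - a₂ * b₁ : ℝ) : ℂ) ≠ 0 := by exact_mod_cast hD
    refine ⟨LinearMap.mem_ker.2 ((smul_eq_zero_iff_right hDC).1 ?_),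
      LinearMap.mem_ker.2 ((smul_eq_zero_iff_right hDC).1 ?_)⟩
    · push_cast
      linear_combination (norm := module) (b₂ : ℂ) • k₁ - (b₁ : ℂ) • k₂
    · push_cast
      linear_combination (norm := module) (a₁ : ℂ) • k₂ - (a₂ : ℂ) • k₁
  set K : Set E := Metric.sphere 0 1 ∩ (Vᗮ : Set E) with hK
  have hKc : IsCompact K := by
    have : ProperSpace E := FiniteDimensional.proper ℂ E
    exact (isCompact_sphere 0 1).inter_right V.isClosed_orthogonal
  have hPneg : ∀ x ∈ K, P x < 0 := by
    intro x hx
    refine lt_of_le_of_ne (by linarith [hPsum x, hneg₁ x, hneg₂ x]) fun h0 => ?_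
    have hx0 : x = 0 := by
      have := V.inner_right_of_mem_orthogonal (hzeroV x h0) hx.2
      exact inner_self_eq_zero.1 this
    have := hx.1
    simp [hx0] at this
  have hred : ∀ x, quadPair S₁ S₂ x = 0 ∨
      ∃ y ∈ K, ∃ r : ℝ, quadPair S₁ S₂ x = (r ^ 2) • quadPair S₁ S₂ y := by
    intro x
    obtain ⟨v, hv, w, hw, rfl⟩ := V.exists_add_mem_mem_orthogonal x
    rw [quadPair_add_of_mem_ker h₁ h₂ (LinearMap.mem_ker.1 hv.1) (LinearMap.mem_ker.1 hv.2)]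
    rcases eq_or_ne w 0 with rfl | hw0
    · left
      simp [quadPair]
    · right
      have hnw : ‖w‖ ≠ 0 := norm_ne_zero_iff.2 hw0
      refine ⟨((‖w‖⁻¹ : ℝ) : ℂ) • w, ⟨?_, Vᗮ.smul_mem _ hw⟩, ‖w‖, ?_⟩
      · simp [norm_smul, hnw]
      · rw [quadPair_smul, smul_smul, ← mul_pow, mul_inv_cancel₀ hnw, one_pow, one_smul]
  have hKne : K.Nonempty := by
    obtain ⟨x, hx⟩ := hne
    rcases hred x with h | ⟨y, hy, -⟩
    · exact absurd h hx
    · exact ⟨y, hy⟩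
  have hcq := continuous_quadPair S₁ S₂
  have hNc : Continuous N := (LinearMap.continuous_of_finiteDimensional _).comp hcq
  have hPc : Continuous P := (LinearMap.continuous_of_finiteDimensional _).comp hcq
  have hf : ContinuousOn (fun x => N x / P x) K :=
    hNc.continuousOn.div hPc.continuousOn fun x hx => (hPneg x hx).ne
  obtain ⟨y, hy, hymin⟩ := hKc.exists_isMinOn hKne hf
  obtain ⟨z, hz, hzmax⟩ := hKc.exists_isMaxOn hKne hf
  have hnz : ∀ x ∈ K, quadPair S₁ S₂ x ≠ 0 := by
    intro x hx h0
    have := hPneg x hx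
    simp [hP, h0] at this
  refine ⟨N y / P y, N z / P z, ?_, ?_, ⟨y, by simpa using hy.1, hnz y hy, ?_⟩,
    ⟨z, by simpa using hz.1, hnz z hz, ?_⟩⟩
  · intro x
    rcases hred x with h | ⟨k, hk, r, hr⟩
    · simp [h]
    · have hle : N y / P y ≤ N k / P k := hymin hk
      rw [le_div_iff_of_neg (hPneg k hk)] at hle
      have := mul_le_mul_of_nonneg_left hle (sq_nonneg r)
      rw [hr, map_smul, map_smul, smul_eq_mul, smul_eq_mul]
      linarith
  · intro x
    rcases hred x with h | ⟨k, hk, r, hr⟩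
    · simp [h]
    · have hle : N k / P k ≤ N z / P z := hzmax hk
      rw [div_le_iff_of_neg (hPneg k hk)] at hle
      have := mul_le_mul_of_nonneg_left hle (sq_nonneg r)
      rw [hr, map_smul, map_smul, smul_eq_mul, smul_eq_mul]
      linarith
  · exact (div_mul_cancel₀ _ (hPneg y hy).ne).symm
  · exact (div_mul_cancel₀ _ (hPneg z hz).ne).symm

/-- The numerical range of two symmetric operators, in coordinates centred at a corner point. -/
theorem exists_two_facets [FiniteDimensional ℂ E] {S₁ S₂ : E →ₗ[ℂ] E}
    (h₁ : S₁.IsSymmetric) (h₂ : S₂.IsSymmetric) {C : Set (ℝ × ℝ)} {p : ℝ × ℝ} (hp : p ∈ C)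
    (hC : C = (fun x => p + quadPair S₁ S₂ x) '' {x | ‖x‖ = 1}) (hdim : convDim C = 2)
    {a₁ b₁ a₂ b₂ : ℝ} (hD : a₁ * b₂ - a₂ * b₁ ≠ 0)
    (hle₁ : ∀ q ∈ C, planeFunctional a₁ b₁ q ≤ planeFunctional a₁ b₁ p)
    (hle₂ : ∀ q ∈ C, planeFunctional a₂ b₂ q ≤ planeFunctional a₂ b₂ p) :
    ∃ F₁ F₂ : Set (ℝ × ℝ), F₁ ≠ F₂ ∧ IsFaceOf C F₁ ∧ IsFaceOf C F₂ ∧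
      convDim F₁ = 1 ∧ convDim F₂ = 1 ∧ p ∈ F₁ ∧ p ∈ F₂ := by
  have hmem : ∀ x, ‖x‖ = 1 → p + quadPair S₁ S₂ x ∈ C := fun x hx => hC ▸ ⟨x, hx, rfl⟩
  have hneg : ∀ a b : ℝ, (∀ q ∈ C, planeFunctional a b q ≤ planeFunctional a b p) →
      ∀ x, planeFunctional a b (quadPair S₁ S₂ x) ≤ 0 := by
    intro a b hle x
    rcases eq_or_ne x 0 with rfl | hx
    · simp [quadPair]
    · have hnx : ‖x‖ ≠ 0 := norm_ne_zero_iff.2 hx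
      have h := hle _ (hmem (((‖x‖⁻¹ : ℝ) : ℂ) • x) (by simp [norm_smul, hnx]))
      rw [map_add, quadPair_smul, map_smul, smul_eq_mul, add_le_iff_nonpos_right] at h
      exact nonpos_of_mul_nonpos_right h (by positivity)
  have hnotline : ∀ a b : ℝ, (a ≠ 0 ∨ b ≠ 0) →
      ¬ ∀ q ∈ C, planeFunctional a b q = planeFunctional a b p := fun a b hab h => by
    have := convDim_le_one (planeFunctional_ne_zero hab) h
    omega
  have hab₁ : a₁ ≠ 0 ∨ b₁ ≠ 0 := by
    by_contra! h
    exact hD (by simp [h])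
  have hne : ∃ x, quadPair S₁ S₂ x ≠ 0 := by
    by_contra! h
    refine hnotline a₁ b₁ hab₁ fun q hq => ?_
    rw [hC] at hq
    obtain ⟨x, -, rfl⟩ := hq
    simp [h x]
  obtain ⟨m, M, hm, hM, ⟨y, hy, hy0, hym⟩, ⟨z, hz, hz0, hzM⟩⟩ :=
    exists_extremal_functionals h₁ h₂ hD (hneg a₁ b₁ hle₁) (hneg a₂ b₂ hle₂) hne
  have hslope : ∀ s : ℝ, a₁ - s * (a₁ + a₂) ≠ 0 ∨ b₁ - s * (b₁ + b₂) ≠ 0 := by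
    intro s
    by_contra! h
    refine hD ?_
    linear_combination (b₁ + b₂) * h.1 - (a₁ + a₂) * h.2
  have happly : ∀ (s : ℝ) (q : ℝ × ℝ),
      planeFunctional (a₁ - s * (a₁ + a₂)) (b₁ - s * (b₁ + b₂)) q =
        planeFunctional a₁ b₁ q - s * planeFunctional (a₁ + a₂) (b₁ + b₂) q := by
    intro s q
    simp only [planeFunctional_apply]
    ring
  have hMslope : -(a₁ - M * (a₁ + a₂)) ≠ 0 ∨ -(b₁ - M * (b₁ + b₂)) ≠ 0 := by
    simpa only [neg_ne_zero] using hslope M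
  have happly_neg : ∀ (a b : ℝ) (q : ℝ × ℝ),
      planeFunctional (-a) (-b) q = -planeFunctional a b q := by
    intro a b q
    simp only [planeFunctional_apply]
    ring
  have hfacet : ∀ a b : ℝ, (a ≠ 0 ∨ b ≠ 0) →
      (∀ x, planeFunctional a b (quadPair S₁ S₂ x) ≤ 0) →
      (∃ x, ‖x‖ = 1 ∧ quadPair S₁ S₂ x ≠ 0 ∧ planeFunctional a b (quadPair S₁ S₂ x) = 0) →
      IsFaceOf C {q ∈ C | planeFunctional a b q = planeFunctional a b p} ∧
      convDim {q ∈ C | planeFunctional a b q = planeFunctional a b p} = 1 := by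
    rintro a b hab hle ⟨x, hx, hx0, hxz⟩
    refine ⟨isFaceOf_supporting_level h₁ h₂ hC hab hle, le_antisymm
      (convDim_le_one (planeFunctional_ne_zero hab) fun q hq => hq.2)
      (convDim_pos (p := p + quadPair S₁ S₂ x) (q := p) ⟨hmem x hx, ?_⟩ ⟨hp, rfl⟩ ?_)⟩
    · rw [map_add, hxz, add_zero]
    · simpa using hx0
  obtain ⟨f₁, d₁⟩ := hfacet _ _ (hslope m) (fun x => by rw [happly]; linarith [hm x])
    ⟨y, hy, hy0, by rw [happly]; linarith⟩
  obtain ⟨f₂, d₂⟩ := hfacet _ _ hMslope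
    (fun x => by rw [happly_neg, happly]; linarith [hM x])
    ⟨z, hz, hz0, by rw [happly_neg, happly]; linarith⟩
  refine ⟨_, _, ?_, f₁, f₂, d₁, d₂, ⟨hp, rfl⟩, ⟨hp, rfl⟩⟩
  intro heq
  have hyF : p + quadPair S₁ S₂ y ∈ {q ∈ C | planeFunctional (a₁ - m * (a₁ + a₂))
      (b₁ - m * (b₁ + b₂)) q = planeFunctional (a₁ - m * (a₁ + a₂)) (b₁ - m * (b₁ + b₂)) p} :=
    ⟨hmem y hy, by rw [map_add, happly _ (quadPair S₁ S₂ y)]; linarith⟩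
  rw [heq] at hyF
  have hyM := hyF.2
  rw [map_add, add_eq_left, happly_neg, happly] at hyM
  have hP0 : planeFunctional (a₁ + a₂) (b₁ + b₂) (quadPair S₁ S₂ y) ≠ 0 := by
    intro h0
    rw [h0, mul_zero] at hym
    refine hy0 (eq_zero_of_planeFunctional_eq_zero hD hym ?_)
    rw [planeFunctional_apply] at *
    linarith
  have hmM : m = M := mul_right_cancel₀ hP0 (by linarith)
  refine hnotline _ _ (hslope m) fun q hq => ?_
  rw [hC] at hq
  obtain ⟨x, -, rfl⟩ := hq
  rw [map_add, add_eq_left, happly]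
  have := hM x
  rw [← hmM] at this
  linarith [hm x]

end QuadraticForm

/-- The joint numerical range, recentred at a point, in terms of operators on Euclidean space. -/
theorem jointNR_eq_image_quadPair {d : ℕ} (u₁ u₂ : Matrix (Fin d) (Fin d) ℂ) (p : ℝ × ℝ) :
    jointNR u₁ u₂ = (fun x => p + quadPair
      (Matrix.toEuclideanLin u₁ - (p.1 : ℂ) • LinearMap.id)
      (Matrix.toEuclideanLin u₂ - (p.2 : ℂ) • LinearMap.id) x) ''
        {x : EuclideanSpace ℂ (Fin d) | ‖x‖ = 1} := by
  have hnorm : ∀ x : EuclideanSpace ℂ (Fin d), star x.ofLp ⬝ᵥ x.ofLp = ((‖x‖ ^ 2 : ℝ) : ℂ) := by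
    intro x
    rw [dotProduct_comm, ← EuclideanSpace.inner_eq_star_dotProduct, inner_self_eq_norm_sq_to_K]
    norm_cast
  have hunit : ∀ x : EuclideanSpace ℂ (Fin d), star x.ofLp ⬝ᵥ x.ofLp = 1 ↔ ‖x‖ = 1 := by
    intro x
    rw [hnorm]
    norm_cast
    exact pow_eq_one_iff_of_nonneg (norm_nonneg x) two_ne_zero
  have hval : ∀ (u : Matrix (Fin d) (Fin d) ℂ) (t : ℝ) (x : EuclideanSpace ℂ (Fin d)), ‖x‖ = 1 →
      t + (inner ℂ x ((Matrix.toEuclideanLin u - (t : ℂ) • LinearMap.id :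
        EuclideanSpace ℂ (Fin d) →ₗ[ℂ] EuclideanSpace ℂ (Fin d)) x)).re =
        (star x.ofLp ⬝ᵥ u.mulVec x.ofLp).re := by
    intro u t x hx
    rw [LinearMap.sub_apply, inner_sub_right, LinearMap.smul_apply, LinearMap.id_apply,
      inner_smul_right, inner_self_eq_norm_sq_to_K, hx, EuclideanSpace.inner_eq_star_dotProduct,
      Matrix.ofLp_toLpLin, Matrix.toLin'_apply, dotProduct_comm]
    simp
  ext q
  constructor
  · rintro ⟨x, hx, rfl⟩
    have hx' := (hunit (WithLp.toLp 2 x)).1 hx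
    exact ⟨WithLp.toLp 2 x, hx', Prod.ext (hval u₁ _ _ hx') (hval u₂ _ _ hx')⟩
  · rintro ⟨x, hx, rfl⟩
    exact ⟨x.ofLp, (hunit x).2 hx, Prod.ext (hval u₁ _ _ hx) (hval u₂ _ _ hx)⟩

theorem LinearMap.IsSymmetric.sub_real_smul_id {E : Type*} [NormedAddCommGroup E]
    [InnerProductSpace ℂ E] {T : E →ₗ[ℂ] E} (hT : T.IsSymmetric) (t : ℝ) :
    (T - (t : ℂ) • LinearMap.id).IsSymmetric := by
  intro x y
  simp only [LinearMap.sub_apply, LinearMap.smul_apply, LinearMap.id_apply, inner_sub_left,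
    inner_sub_right, inner_smul_left, inner_smul_right, Complex.conj_ofReal, hT x y]

theorem corner_point_lies_in_two_facets {d : ℕ} (u₁ u₂ : Matrix (Fin d) (Fin d) ℂ)
    (h₁ : u₁.IsHermitian) (h₂ : u₂.IsHermitian)
    (hdim : convDim (jointNR u₁ u₂) = 2)
    (p : ℝ × ℝ) (hp : IsCornerPoint (jointNR u₁ u₂) p) :
    ∃ F₁ F₂ : Set (ℝ × ℝ), F₁ ≠ F₂ ∧
      IsFaceOf (jointNR u₁ u₂) F₁ ∧ IsFaceOf (jointNR u₁ u₂) F₂ ∧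
      convDim F₁ = 1 ∧ convDim F₂ = 1 ∧ p ∈ F₁ ∧ p ∈ F₂ := by
  obtain ⟨hpC, l₁, l₂, hl, ⟨φ₁, c₁, hφ₁, rfl, rfl, hle₁⟩, ⟨φ₂, c₂, hφ₂, rfl, rfl, hle₂⟩⟩ := hp
  rw [eq_planeFunctional φ₁] at hl hφ₁ hle₁
  rw [eq_planeFunctional φ₂] at hl hφ₂ hle₂
  generalize φ₁ (1, 0) = a₁ at *
  generalize φ₁ (0, 1) = b₁ at *
  generalize φ₂ (1, 0) = a₂ at *
  generalize φ₂ (0, 1) = b₂ at *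
  have hab₁ := coeff_ne_zero_of_planeFunctional_ne_zero hφ₁
  have hab₂ := coeff_ne_zero_of_planeFunctional_ne_zero hφ₂
  have hD : a₁ * b₂ - a₂ * b₁ ≠ 0 := by
    intro hD
    refine hl (Set.ext fun q => ?_)
    simp only [Set.mem_ofPred_eq]
    rw [← sub_eq_zero, ← map_sub, ← sub_eq_zero (a := planeFunctional a₂ b₂ q), ← map_sub]
    exact ⟨planeFunctional_eq_zero_of_det_eq_zero hab₁ hD,
      planeFunctional_eq_zero_of_det_eq_zero hab₂ (by linarith)⟩
  exact exists_two_facets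
    ((Matrix.isSymmetric_toEuclideanLin_iff.2 h₁).sub_real_smul_id p.1)
    ((Matrix.isSymmetric_toEuclideanLin_iff.2 h₂).sub_real_smul_id p.2)
    hpC (jointNR_eq_image_quadPair u₁ u₂ p) hdim hD hle₁ hle₂
end

section
/- Let u_1, u_2 ∈ M_d be hermitian. Then every point of W(u_1,u_2) is either a round boundary point of W(u_1,u_2) or a simplicial point of W(u_1,u_2), but not both. -/
open Set Filter Topology Matrix
open scoped ComplexOrder

lemma isSimplicialPoint_of_convexHull_mem_nhdsWithin {Y : Type*} [AddCommGroup Y] [Module ℝ Y]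
    [TopologicalSpace Y] {C : Set Y} (hC : Convex ℝ C) {w : Y} (V : Finset Y)
    (hV : (V : Set Y) ⊆ C) (h : convexHull ℝ (V : Set Y) ∈ 𝓝[C] w) : IsSimplicialPoint C w := by
  classical
  set F : Finset (Finset Y) :=
    V.powerset.filter fun t => AffineIndependent ℝ ((↑) : t → Y)
  have hmem : ∀ i : Fin F.card, ((F.equivFin.symm i : F) : Finset Y) ∈ F := fun i => Subtype.prop _
  refine ⟨F.card, fun i => convexHull ℝ (((F.equivFin.symm i : F) : Finset Y) : Set Y),
    fun i => ⟨⟨_, ?_, rfl⟩, ?_⟩, ?_⟩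
  · have := hmem i
    exact (Finset.mem_filter.1 this).2
  · have := hmem i
    exact convexHull_min ((Finset.coe_subset.2
      (Finset.mem_powerset.1 (Finset.mem_filter.1 this).1)).trans hV) hC
  · refine Filter.mem_of_superset h fun x hx => ?_
    rw [convexHull_eq_union] at hx
    simp only [mem_iUnion, exists_prop] at hx ⊢
    obtain ⟨t, htV, hti, hxt⟩ := hx
    have htF : t ∈ F := Finset.mem_filter.2 ⟨Finset.mem_powerset.2 (by exact_mod_cast htV), hti⟩
    exact ⟨F.equivFin ⟨t, htF⟩, by simpa using hxt⟩

lemma isSimplicialPoint_of_mem_interior {C : Set (ℝ × ℝ)} (hC : Convex ℝ C) {p : ℝ × ℝ}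
    (hp : p ∈ interior C) : IsSimplicialPoint C p := by
  obtain ⟨b, hb, hbC⟩ := exists_mem_interior_convexHull_affineBasis (mem_interior_iff_mem_nhds.1 hp)
  have hr : (((Set.finite_range b).toFinset : Finset (ℝ × ℝ)) : Set (ℝ × ℝ)) = range b :=
    Set.Finite.coe_toFinset _
  refine isSimplicialPoint_of_convexHull_mem_nhdsWithin hC (Set.finite_range b).toFinset ?_ ?_
  · rw [hr]; exact (subset_convexHull ℝ _).trans hbC
  · rw [hr]; exact mem_nhdsWithin_of_mem_nhds (mem_interior_iff_mem_nhds.1 hb)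

/-- Three points and nonnegative weights summing to one. -/
lemma convexCombination_mem_convexHull_three {a b c q : ℝ × ℝ} {x y z : ℝ} (hx : 0 ≤ x)
    (hy : 0 ≤ y) (hz : 0 ≤ z) (hs : x + y + z = 1) (hq : q = x • a + y • b + z • c) :
    q ∈ convexHull ℝ ({a, b, c} : Set (ℝ × ℝ)) := by
  have hcv := convex_convexHull ℝ ({a, b, c} : Set (ℝ × ℝ))
  have hsub := subset_convexHull ℝ ({a, b, c} : Set (ℝ × ℝ))
  have := hcv.sum_mem (t := Finset.univ) (w := ![x, y, z]) (z := ![a, b, c])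
    (by intro i _; fin_cases i <;> simp [hx, hy, hz])
    (by simp [Fin.sum_univ_three, hs])
    (by intro i _; fin_cases i <;> apply hsub <;> simp)
  simpa [Fin.sum_univ_three, ← hq] using this

lemma linearMap_prod_apply (φ : (ℝ × ℝ) →ₗ[ℝ] ℝ) (q : ℝ × ℝ) :
    φ q = φ (1, 0) * q.1 + φ (0, 1) * q.2 := by
  have h : q = q.1 • ((1, 0) : ℝ × ℝ) + q.2 • ((0, 1) : ℝ × ℝ) := by ext <;> simp
  conv_lhs => rw [h]
  rw [map_add, map_smul, map_smul, smul_eq_mul, smul_eq_mul]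
  ring

lemma linearMap_prod_ne_zero {φ : (ℝ × ℝ) →ₗ[ℝ] ℝ} (h : φ ≠ 0) :
    φ (1, 0) ≠ 0 ∨ φ (0, 1) ≠ 0 := by
  by_contra! hc
  exact h (LinearMap.ext fun q => by rw [linearMap_prod_apply, hc.1, hc.2]; simp)

/-- A convex set has a supporting functional at each of its points outside the interior. -/
lemma exists_support_of_notMem_interior {C : Set (ℝ × ℝ)} (hC : Convex ℝ C) {p : ℝ × ℝ}
    (hp : p ∈ C) (hpi : p ∉ interior C) :
    ∃ φ : (ℝ × ℝ) →ₗ[ℝ] ℝ, φ ≠ 0 ∧ ∀ q ∈ C, φ q ≤ φ p := by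
  by_cases hi : (interior C).Nonempty
  · obtain ⟨f, hf, hle⟩ := geometric_hahn_banach_of_nonempty_interior_point hC hpi hi
    refine ⟨f.toLinearMap, fun h => hf (ContinuousLinearMap.ext fun x => ?_), hle⟩
    exact LinearMap.congr_fun h x
  · rw [hC.interior_nonempty_iff_affineSpan_eq_top] at hi
    have hne : (affineSpan ℝ C : Set (ℝ × ℝ)).Nonempty := ⟨p, subset_affineSpan ℝ C hp⟩
    have hlt : (affineSpan ℝ C).direction < ⊤ := by
      refine lt_top_iff_ne_top.2 fun h => hi ?_
      exact (AffineSubspace.direction_eq_top_iff_of_nonempty hne).1 h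
    obtain ⟨f, hf, hker⟩ := Submodule.exists_le_ker_of_lt_top _ hlt
    refine ⟨f, hf, fun q hq => ?_⟩
    have hd : q - p ∈ (affineSpan ℝ C).direction :=
      AffineSubspace.vsub_mem_direction (subset_affineSpan ℝ C hq) (subset_affineSpan ℝ C hp)
    have := hker hd
    rw [LinearMap.mem_ker, map_sub] at this
    linarith

lemma notMem_interior_of_support {C : Set (ℝ × ℝ)} {p : ℝ × ℝ} {φ : (ℝ × ℝ) →ₗ[ℝ] ℝ}
    (hφ : φ ≠ 0) (hle : ∀ q ∈ C, φ q ≤ φ p) : p ∉ interior C := by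
  intro hp
  have hmax : ∀ v, φ v ≤ 0 := by
    intro v
    have hcont : Tendsto (fun t : ℝ => p + t • v) (𝓝[>] 0) (𝓝 p) := by
      have : Continuous fun t : ℝ => p + t • v := by fun_prop
      simpa using (this.tendsto 0).mono_left nhdsWithin_le_nhds
    obtain ⟨t, ht, ht0⟩ := ((hcont.eventually_mem (mem_interior_iff_mem_nhds.1 hp)).and
      self_mem_nhdsWithin).exists
    have := hle _ ht
    rw [map_add, map_smul, smul_eq_mul] at this
    have ht0' : 0 < t := ht0
    nlinarith
  refine hφ (LinearMap.ext fun v => le_antisymm (hmax v) ?_)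
  have := hmax (-v)
  rw [map_neg] at this
  simpa using this

/-- A point in the relative interior of a flat boundary portion is simplicial. -/
lemma isSimplicialPoint_of_flat {C : Set (ℝ × ℝ)} (hC : Convex ℝ C) (hcl : IsClosed C)
    {p a b : ℝ × ℝ} (hab : a ≠ b) (hseg : segment ℝ a b ⊆ frontier C)
    (hp : p ∈ openSegment ℝ a b) : IsSimplicialPoint C p := by
  have hpf : p ∈ frontier C := hseg (openSegment_subset_segment ℝ a b hp)
  have hfC : frontier C ⊆ C := hcl.frontier_subset
  have ha : a ∈ C := hfC (hseg (left_mem_segment ℝ a b))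
  have hb : b ∈ C := hfC (hseg (right_mem_segment ℝ a b))
  obtain ⟨φ, hφ, hle⟩ := exists_support_of_notMem_interior hC (hfC hpf) hpf.2
  obtain ⟨s, θ, hs, hθ, hsθ, hpe⟩ := hp
  have hφp : φ p = s * φ a + θ * φ b := by rw [← hpe]; simp
  have hφa : φ a = φ p := by
    have := hle a ha; have := hle b hb
    have : s = 1 - θ := by linarith
    subst this
    nlinarith
  have hφb : φ b = φ p := by
    have := hle a ha; have := hle b hb
    have : θ = 1 - s := by linarith
    subst this
    nlinarith
  -- `c` is a point off the supporting line, if there is any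
  obtain ⟨c, hc, hcφ⟩ : ∃ c ∈ C, ∀ q ∈ C, φ q = φ p + (φ q - φ p) / (φ c - φ p) * (φ c - φ p) := by
    by_cases h : ∃ c ∈ C, φ c ≠ φ p
    · obtain ⟨c, hc, hne⟩ := h
      exact ⟨c, hc, fun q _ => by rw [div_mul_cancel₀ _ (sub_ne_zero.2 hne)]; ring⟩
    · push Not at h
      exact ⟨a, ha, fun q hq => by rw [h q hq, h a ha]; ring⟩
  set e := b - a with he
  have he0 : 0 < e.1 * e.1 + e.2 * e.2 := by
    have : e.1 ≠ 0 ∨ e.2 ≠ 0 := by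
      by_contra! hcon
      exact hab (sub_eq_zero.1 (Prod.ext hcon.1 hcon.2 : e = 0)).symm
    rcases this with h | h <;> nlinarith [mul_self_pos.2 h, mul_self_nonneg e.1, mul_self_nonneg e.2]
  have hφe : φ e = 0 := by rw [he, map_sub, hφa, hφb, sub_self]
  have hker : ∀ v : ℝ × ℝ, φ v = 0 →
      v = ((v.1 * e.1 + v.2 * e.2) / (e.1 * e.1 + e.2 * e.2)) • e := by
    intro v hv
    rw [linearMap_prod_apply] at hv hφe
    have hdet : v.1 * e.2 = v.2 * e.1 := by
      rcases linearMap_prod_ne_zero hφ with h | h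
      · apply mul_left_cancel₀ h; linear_combination e.2 * hv - v.2 * hφe
      · apply mul_left_cancel₀ h; linear_combination v.1 * hφe - e.1 * hv
    ext
    · simp only [Prod.smul_fst, smul_eq_mul]
      rw [div_mul_eq_mul_div, eq_div_iff he0.ne']
      linear_combination e.2 * hdet
    · simp only [Prod.smul_snd, smul_eq_mul]
      rw [div_mul_eq_mul_div, eq_div_iff he0.ne']
      linear_combination -e.1 * hdet
  set A : ℝ × ℝ → ℝ := fun q => (φ q - φ p) / (φ c - φ p) with hA
  set v : ℝ × ℝ → ℝ × ℝ := fun q => q - p - A q • (c - p) with hv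
  set B : ℝ × ℝ → ℝ := fun q =>
    ((v q).1 * e.1 + (v q).2 * e.2) / (e.1 * e.1 + e.2 * e.2) with hB
  have hφc : Continuous φ := φ.continuous_of_finiteDimensional
  have hAc : Continuous A := by
    simp only [hA, div_eq_mul_inv]; fun_prop
  have hvc : Continuous v := by fun_prop
  have hBc : Continuous B := by simp only [hB, div_eq_mul_inv]; fun_prop
  have hAp : A p = 0 := by simp [hA]
  have hBp : B p = 0 := by simp [hB, hv, hAp]
  have hev : ∀ᶠ q in 𝓝[C] p, 0 ≤ θ * (1 - A q) + B q ∧ 0 ≤ (1 - θ) * (1 - A q) - B q := by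
    have h1 : ∀ᶠ q in 𝓝 p, 0 < θ * (1 - A q) + B q := by
      have : Continuous fun q => θ * (1 - A q) + B q := by fun_prop
      exact this.continuousAt.eventually (lt_mem_nhds (by simp [hAp, hBp, hθ]))
    have h2 : ∀ᶠ q in 𝓝 p, 0 < (1 - θ) * (1 - A q) - B q := by
      have : Continuous fun q => (1 - θ) * (1 - A q) - B q := by fun_prop
      exact this.continuousAt.eventually (lt_mem_nhds (by simp [hAp, hBp]; linarith))
    filter_upwards [mem_nhdsWithin_of_mem_nhds h1, mem_nhdsWithin_of_mem_nhds h2] with q h h'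
    exact ⟨le_of_lt h, le_of_lt h'⟩
  refine isSimplicialPoint_of_convexHull_mem_nhdsWithin hC {a, b, c} ?_ ?_
  · intro x hx
    simp only [Finset.coe_insert, Finset.coe_singleton, mem_insert_iff, mem_singleton_iff] at hx
    rcases hx with rfl | rfl | rfl <;> assumption
  · filter_upwards [hev, self_mem_nhdsWithin] with q hq hqC
    push_cast
    have hA0 : 0 ≤ A q := div_nonneg_of_nonpos (by linarith [hle q hqC]) (by linarith [hle c hc])
    refine convexCombination_mem_convexHull_three hq.2 hq.1 hA0 (by ring) ?_
    have hvq : φ (v q) = 0 := by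
      have := hcφ q hqC
      simp only [hv, map_sub, map_smul, smul_eq_mul]
      simp only [hA]
      linarith
    have hvB : v q = B q • e := hker _ hvq
    have hq' : q = p + A q • (c - p) + B q • e := by rw [← hvB]; simp [hv]
    have hs' : s = 1 - θ := by linarith
    subst hs'
    rw [← hpe] at hq'
    generalize A q = α at *
    generalize B q = β at *
    rw [hq', he]
    module

/-- A point of a plane convex set which is both simplicial and on the boundary is a corner point
or lies in the relative interior of a flat boundary portion. -/
lemma not_isRoundBoundaryPoint_of_isSimplicialPoint {C : Set (ℝ × ℝ)} (hC : Convex ℝ C)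
    {p : ℝ × ℝ} (hp : p ∈ C) (hsim : IsSimplicialPoint C p) : ¬ IsRoundBoundaryPoint C p := by
  classical
  rintro ⟨hpf, hcor, hflat⟩
  obtain ⟨φ, hφ, hle⟩ := exists_support_of_notMem_interior hC hp hpf.2
  obtain ⟨m, S, hS, hmem⟩ := hsim
  choose V hV using fun i => (hS i).1
  set U : Finset (ℝ × ℝ) := Finset.univ.biUnion V with hU
  have hUC : ∀ v ∈ U, v ∈ C := by
    intro v hv
    obtain ⟨i, -, hi⟩ := Finset.mem_biUnion.1 hv
    refine (hS i).2 ?_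
    rw [(hV i).2]
    exact subset_convexHull ℝ _ hi
  -- a functional maximal at `p` over the vertices is maximal at `p` over `C`
  have hext : ∀ χ : (ℝ × ℝ) →ₗ[ℝ] ℝ, (∀ v ∈ U, χ v ≤ χ p) → ∀ q ∈ C, χ q ≤ χ p := by
    intro χ hχ q hq
    have hT : Tendsto (fun t : ℝ => p + t • (q - p)) (𝓝[>] 0) (𝓝[C] p) := by
      refine tendsto_nhdsWithin_iff.2 ⟨?_, ?_⟩
      · have : Continuous fun t : ℝ => p + t • (q - p) := by fun_prop
        simpa using (this.tendsto 0).mono_left nhdsWithin_le_nhds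
      · filter_upwards [Ioc_mem_nhdsGT (show (0 : ℝ) < 1 by norm_num)] with t ht
        exact hC.add_smul_sub_mem hp hq ⟨ht.1.le, ht.2⟩
    obtain ⟨t, ht, ht0⟩ := ((hT.eventually_mem hmem).and self_mem_nhdsWithin).exists
    have ht0' : 0 < t := ht0
    obtain ⟨i, hi⟩ := mem_iUnion.1 ht
    rw [(hV i).2] at hi
    have hsub : convexHull ℝ (V i : Set (ℝ × ℝ)) ⊆ {x | χ x ≤ χ p} :=
      convexHull_min (fun v hv => hχ v (Finset.mem_biUnion.2 ⟨i, Finset.mem_univ _, hv⟩))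
        (convex_halfSpace_le χ.isLinear _)
    have := hsub hi
    simp only [mem_ofPred_eq, map_add, map_smul, map_sub, smul_eq_mul] at this
    nlinarith
  set ψ : (ℝ × ℝ) →ₗ[ℝ] ℝ :=
    φ (1, 0) • LinearMap.snd ℝ ℝ ℝ - φ (0, 1) • LinearMap.fst ℝ ℝ ℝ with hψ
  have hψa : ∀ q, ψ q = φ (1, 0) * q.2 - φ (0, 1) * q.1 := fun q => by simp [hψ]
  have hinj : ∀ v, φ v = 0 → ψ v = 0 → v = 0 := by
    intro v h hψv
    rw [linearMap_prod_apply] at h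
    rw [hψa] at hψv
    have hpos : 0 < φ (1, 0) * φ (1, 0) + φ (0, 1) * φ (0, 1) := by
      rcases linearMap_prod_ne_zero hφ with h | h <;>
        nlinarith [mul_self_pos.2 h, mul_self_nonneg (φ (1, 0)), mul_self_nonneg (φ (0, 1))]
    ext
    · apply mul_left_cancel₀ hpos.ne'
      simp only [Prod.fst_zero, mul_zero]
      linear_combination φ (1, 0) * h - φ (0, 1) * hψv
    · apply mul_left_cancel₀ hpos.ne'
      simp only [Prod.snd_zero, mul_zero]
      linear_combination φ (0, 1) * h + φ (1, 0) * hψv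
  -- no functional close to `φ` in the direction `χ = ±ψ` is maximal at `p`
  have key : ∀ χ : (ℝ × ℝ) →ₗ[ℝ] ℝ, (χ = ψ ∨ χ = -ψ) → ∃ v ∈ U, φ v = φ p ∧ χ p < χ v := by
    intro χ hχ
    by_contra! hcon
    have hev : ∀ᶠ ε : ℝ in 𝓝[>] 0, ∀ v ∈ U, φ v + ε * χ v ≤ φ p + ε * χ p := by
      rw [Filter.eventually_all_finset]
      intro v hv
      rcases (hle v (hUC v hv)).lt_or_eq with hlt | heq
      · have : Tendsto (fun ε : ℝ => φ p + ε * χ p - (φ v + ε * χ v)) (𝓝[>] 0) (𝓝 (φ p - φ v)) := by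
          have : Continuous fun ε : ℝ => φ p + ε * χ p - (φ v + ε * χ v) := by fun_prop
          simpa using (this.tendsto 0).mono_left nhdsWithin_le_nhds
        filter_upwards [this (lt_mem_nhds (sub_pos.2 hlt))] with ε hε
        have : 0 < φ p + ε * χ p - (φ v + ε * χ v) := hε
        linarith
      · filter_upwards [self_mem_nhdsWithin] with ε hε
        have h0 : 0 < ε := hε
        have := hcon v hv heq
        nlinarith
    obtain ⟨ε, hε, hε0⟩ := (hev.and self_mem_nhdsWithin).exists
    have hε0' : 0 < ε := hε0
    have hmax := hext (φ + ε • χ) (by simpa using hε)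
    -- `u` spans the kernel of `φ`
    set u : ℝ × ℝ := (-φ (0, 1), φ (1, 0)) with hu
    have hφu : φ u = 0 := by rw [linearMap_prod_apply, hu]; ring
    have hu0 : u ≠ 0 := by
      intro h
      have h1 := congrArg Prod.fst h
      have h2 := congrArg Prod.snd h
      simp only [hu, Prod.fst_zero, Prod.snd_zero, neg_eq_zero] at h1 h2
      rcases linearMap_prod_ne_zero hφ with h | h <;> contradiction
    have hψu : ψ u ≠ 0 := fun h => hu0 (hinj u hφu h)
    have hχu : χ u ≠ 0 := by rcases hχ with rfl | rfl <;> simpa using hψu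
    have hne : (φ + ε • χ) u ≠ 0 := by simp [hφu, hχu, hε0'.ne']
    refine hcor ⟨hp, {q | φ q = φ p}, {q | (φ + ε • χ) q = (φ + ε • χ) p}, ?_,
      ⟨φ, _, hφ, rfl, rfl, hle⟩, ⟨φ + ε • χ, _, ?_, rfl, rfl, hmax⟩⟩
    · intro h
      have h1 : p + u ∈ {q | φ q = φ p} := by simp [hφu]
      rw [h, mem_ofPred_eq, map_add] at h1
      exact hne (by linarith)
    · intro h; rw [h] at hne; exact hne rfl
  obtain ⟨v, hv, hφv, hψv⟩ := key ψ (Or.inl rfl)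
  obtain ⟨w, hw, hφw, hψw⟩ := key (-ψ) (Or.inr rfl)
  simp only [LinearMap.neg_apply, neg_lt_neg_iff] at hψw
  have hvC := hUC v hv
  have hwC := hUC w hw
  refine hflat ⟨v, w, ?_, ?_, ?_⟩
  · rintro rfl; linarith
  · intro x hx
    have hxC := hC.segment_subset hvC hwC hx
    have hxφ : φ x = φ p := by
      obtain ⟨s, t, -, -, hst, rfl⟩ := hx
      simp only [map_add, map_smul, smul_eq_mul, hφv, hφw]
      rw [← add_mul, hst, one_mul]
    refine ⟨subset_closure hxC, notMem_interior_of_support hφ fun q hq => ?_⟩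
    rw [hxφ]; exact hle q hq
  · have hd : 0 < ψ v - ψ w := by linarith
    refine ⟨(ψ p - ψ w) / (ψ v - ψ w), (ψ v - ψ p) / (ψ v - ψ w), div_pos (by linarith) hd,
      div_pos (by linarith) hd, by field_simp; ring, ?_⟩
    rw [← sub_eq_zero]
    apply hinj
    · simp only [map_sub, map_add, map_smul, smul_eq_mul, hφv, hφw]
      field_simp; ring
    · simp only [map_sub, map_add, map_smul, smul_eq_mul]
      field_simp; ring

/-- The two functionals supporting at a corner point are linearly independent. -/
lemma IsCornerPoint.exists_functionals {C : Set (ℝ × ℝ)} {p : ℝ × ℝ} (h : IsCornerPoint C p) :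
    ∃ φ χ : (ℝ × ℝ) →ₗ[ℝ] ℝ, φ (1, 0) * χ (0, 1) - φ (0, 1) * χ (1, 0) ≠ 0 ∧
      (∀ q ∈ C, φ q ≤ φ p) ∧ ∀ q ∈ C, χ q ≤ χ p := by
  obtain ⟨-, l₁, l₂, hl, ⟨φ, c, hφ, rfl, hc, hle⟩, ⟨χ, c', hχ, rfl, hc', hle'⟩⟩ := h
  subst hc hc'
  refine ⟨φ, χ, fun hdet => hl ?_, hle, hle'⟩
  ext q
  simp only [mem_ofPred_eq]
  rw [linearMap_prod_apply φ q, linearMap_prod_apply φ p, linearMap_prod_apply χ q,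
    linearMap_prod_apply χ p]
  constructor
  · intro h
    rcases linearMap_prod_ne_zero hφ with h0 | h0
    · apply mul_left_cancel₀ h0
      linear_combination χ (1, 0) * h + (q.2 - p.2) * hdet
    · apply mul_left_cancel₀ h0
      linear_combination χ (0, 1) * h - (q.1 - p.1) * hdet
  · intro h
    rcases linearMap_prod_ne_zero hχ with h0 | h0
    · apply mul_left_cancel₀ h0
      linear_combination φ (1, 0) * h - (q.2 - p.2) * hdet
    · apply mul_left_cancel₀ h0
      linear_combination φ (0, 1) * h + (q.1 - p.1) * hdet

/-- A corner point is simplicial if the set is contained in the cone over a compact subset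
avoiding the corner point. -/
lemma IsCornerPoint.isSimplicialPoint {C K : Set (ℝ × ℝ)} (hC : Convex ℝ C) (hK : IsCompact K)
    (hKC : K ⊆ C) {p : ℝ × ℝ} (hpK : p ∉ K) (hcor : IsCornerPoint C p)
    (hcone : ∀ q ∈ C, q = p ∨ ∃ t : ℝ, 0 ≤ t ∧ ∃ k ∈ K, q - p = t • (k - p)) :
    IsSimplicialPoint C p := by
  have hpC : p ∈ C := hcor.1
  rcases K.eq_empty_or_nonempty with rfl | hKne
  · refine isSimplicialPoint_of_convexHull_mem_nhdsWithin hC {p} (by simpa using hpC) ?_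
    filter_upwards [self_mem_nhdsWithin] with q hq
    simpa using hcone q hq
  obtain ⟨φ, χ, hdet, hφ, hχ⟩ := hcor.exists_functionals
  have hinj : ∀ v, φ v = 0 → χ v = 0 → v = 0 := by
    intro v h h'
    rw [linearMap_prod_apply] at h h'
    ext
    · apply mul_left_cancel₀ hdet
      simp only [Prod.fst_zero, mul_zero]
      linear_combination χ (0, 1) * h - φ (0, 1) * h'
    · apply mul_left_cancel₀ hdet
      simp only [Prod.snd_zero, mul_zero]
      linear_combination φ (1, 0) * h' - χ (1, 0) * h
  have hφc : Continuous φ := φ.continuous_of_finiteDimensional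
  have hχc : Continuous χ := χ.continuous_of_finiteDimensional
  set g : ℝ × ℝ → ℝ := fun q => φ p - φ q with hg
  set f : ℝ × ℝ → ℝ := fun q => (φ p - φ q) + (χ p - χ q) with hf
  have hgc : Continuous g := by fun_prop
  have hfc : Continuous f := by fun_prop
  have hfpos : ∀ k ∈ K, 0 < f k := by
    intro k hk
    have h1 := hφ k (hKC hk)
    have h2 := hχ k (hKC hk)
    have h0 : 0 ≤ f k := by simp only [hf]; linarith
    refine lt_of_le_of_ne h0 fun h => hpK ?_
    have : k - p = 0 := hinj _ (by rw [map_sub]; simp only [hf] at h; linarith)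
      (by rw [map_sub]; simp only [hf] at h; linarith)
    rwa [← sub_eq_zero.1 this]
  have hrc : ContinuousOn (fun k => g k / f k) K :=
    hgc.continuousOn.div hfc.continuousOn fun k hk => (hfpos k hk).ne'
  obtain ⟨a, ha, hamin⟩ := hK.exists_isMinOn hKne hrc
  obtain ⟨b, hb, hbmax⟩ := hK.exists_isMaxOn hKne hrc
  obtain ⟨c, hc, hcmin⟩ := hK.exists_isMinOn hKne hfc.continuousOn
  have hev : ∀ᶠ q in 𝓝[C] p, f q < f c := by
    refine mem_nhdsWithin_of_mem_nhds (hfc.continuousAt.eventually (gt_mem_nhds ?_))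
    simpa [hf] using hfpos c hc
  refine isSimplicialPoint_of_convexHull_mem_nhdsWithin hC {p, a, b} ?_ ?_
  · intro x hx
    simp only [Finset.coe_insert, Finset.coe_singleton, mem_insert_iff, mem_singleton_iff] at hx
    rcases hx with rfl | rfl | rfl
    exacts [hpC, hKC ha, hKC hb]
  · filter_upwards [hev, self_mem_nhdsWithin] with q hq hqC
    push_cast
    rcases hcone q hqC with rfl | ⟨t, ht, k, hk, hqk⟩
    · exact subset_convexHull ℝ _ (by simp)
    have hfa := hfpos a ha
    have hfb := hfpos b hb
    have hfk := hfpos k hk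
    have hca : f c ≤ f a := hcmin ha
    have hcb : f c ≤ f b := hcmin hb
    obtain ⟨r, s, hr, hs, hrs, hk'⟩ : g k / f k ∈ segment ℝ (g a / f a) (g b / f b) :=
      Icc_subset_segment ⟨hamin hk, hbmax hk⟩
    have hφqk := congrArg φ hqk
    have hχqk := congrArg χ hqk
    simp only [map_sub, map_smul, smul_eq_mul] at hφqk hχqk hk'
    have hfq : f q = t * f k := by simp only [hf]; linear_combination -hφqk - hχqk
    have hgq : g q = t * f k * (g k / f k) := by
      rw [mul_assoc, mul_div_cancel₀ _ hfk.ne']; simp only [hg]; linear_combination -hφqk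
    have hfq0 : 0 ≤ f q := by rw [hfq]; positivity
    have hya : f q * r / f a ≤ r := by
      rw [div_le_iff₀ hfa, mul_comm]; exact mul_le_mul_of_nonneg_left (by linarith) hr
    have hzb : f q * s / f b ≤ s := by
      rw [div_le_iff₀ hfb, mul_comm]; exact mul_le_mul_of_nonneg_left (by linarith) hs
    have hgsum : g q = f q * r / f a * g a + f q * s / f b * g b := by
      rw [hgq, ← hk', hfq]; ring
    have hfsum : f q = f q * r / f a * f a + f q * s / f b * f b := by
      rw [div_mul_cancel₀ _ hfa.ne', div_mul_cancel₀ _ hfb.ne', ← mul_add, hrs, mul_one]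
    refine convexCombination_mem_convexHull_three
      (x := 1 - f q * r / f a - f q * s / f b) (y := f q * r / f a) (z := f q * s / f b)
      (by linarith) (by positivity) (by positivity) (by ring) ?_
    generalize f q * r / f a = y at *
    generalize f q * s / f b = z at *
    simp only [hg] at hgsum
    simp only [hf] at hfsum
    rw [← sub_eq_zero]
    apply hinj
    · simp only [map_sub, map_add, map_smul, smul_eq_mul]
      linear_combination -hgsum
    · simp only [map_sub, map_add, map_smul, smul_eq_mul]
      linear_combination hgsum - hfsum

section QuadraticForms

variable {V : Type*} [NormedAddCommGroup V] [InnerProductSpace ℂ V]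

/-- The pair of values of two quadratic forms at a vector. -/
noncomputable def jointValue (T₁ T₂ : V →ₗ[ℂ] V) (x : V) : ℝ × ℝ :=
  ((inner ℂ x (T₁ x)).re, (inner ℂ x (T₂ x)).re)

lemma re_inner_map_smul (T : V →ₗ[ℂ] V) (c : ℂ) (x : V) :
    (inner ℂ (c • x) (T (c • x))).re = ‖c‖ ^ 2 * (inner ℂ x (T x)).re := by
  rw [map_smul, inner_smul_left, inner_smul_right, ← mul_assoc, Complex.conj_mul',
    ← Complex.ofReal_pow, Complex.re_ofReal_mul]

lemma jointValue_smul (T₁ T₂ : V →ₗ[ℂ] V) (c : ℂ) (x : V) :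
    jointValue T₁ T₂ (c • x) = ‖c‖ ^ 2 • jointValue T₁ T₂ x := by
  simp only [jointValue, re_inner_map_smul, Prod.smul_mk, smul_eq_mul]

lemma LinearMap.IsSymmetric.re_inner_map_add {T : V →ₗ[ℂ] V} (hT : T.IsSymmetric) (x y : V) :
    (inner ℂ (x + y) (T (x + y))).re =
      (inner ℂ x (T x)).re + 2 * (inner ℂ x (T y)).re + (inner ℂ y (T y)).re := by
  have h : (inner ℂ y (T x)).re = (inner ℂ x (T y)).re := by
    rw [← hT y x, ← inner_conj_symm, Complex.conj_re]
  simp only [map_add, inner_add_left, inner_add_right, Complex.add_re, h]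
  ring

lemma LinearMap.IsSymmetric.real_linearCombination {T₁ T₂ : V →ₗ[ℂ] V} (h₁ : T₁.IsSymmetric)
    (h₂ : T₂.IsSymmetric) (α β : ℝ) : ((α : ℂ) • T₁ + (β : ℂ) • T₂).IsSymmetric := by
  intro x y
  simp only [LinearMap.add_apply, LinearMap.smul_apply, inner_add_left, inner_add_right,
    inner_smul_left, inner_smul_right, Complex.conj_ofReal, h₁ x y, h₂ x y]

lemma re_inner_real_linearCombination (T₁ T₂ : V →ₗ[ℂ] V) (α β : ℝ) (x : V) :
    (inner ℂ x (((α : ℂ) • T₁ + (β : ℂ) • T₂) x)).re =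
      α * (jointValue T₁ T₂ x).1 + β * (jointValue T₁ T₂ x).2 := by
  simp [jointValue]

lemma exists_unit_smul_re_eq_zero (z : ℂ) : ∃ c : ℂ, ‖c‖ = 1 ∧ (c * z).re = 0 := by
  by_cases hz : z = 0
  · exact ⟨1, by simp, by simp [hz]⟩
  · refine ⟨Complex.I * (starRingEnd ℂ z / ‖z‖), ?_, ?_⟩
    · have : ‖z‖ ≠ 0 := norm_ne_zero_iff.2 hz
      simp [this]
    · have : Complex.I * (starRingEnd ℂ z / ‖z‖) * z = Complex.I * ((‖z‖ : ℝ) : ℂ) := by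
        have h : ((‖z‖ : ℝ) : ℂ) ≠ 0 := by exact_mod_cast norm_ne_zero_iff.2 hz
        have h2 := Complex.conj_mul' z
        field_simp
        linear_combination h2
      rw [this]
      simp

/-- The **Toeplitz–Hausdorff theorem**. -/
theorem convex_image_jointValue_sphere [FiniteDimensional ℂ V] {T₁ T₂ : V →ₗ[ℂ] V}
    (h₁ : T₁.IsSymmetric) (h₂ : T₂.IsSymmetric) :
    Convex ℝ (jointValue T₁ T₂ '' Metric.sphere 0 1) := by
  rw [convex_iff_segment_subset]
  rintro _ ⟨x₀, hx₀, rfl⟩ _ ⟨y, hy, rfl⟩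
  by_cases hne : jointValue T₁ T₂ x₀ = jointValue T₁ T₂ y
  · rw [hne, segment_same, singleton_subset_iff]
    exact ⟨y, hy, rfl⟩
  rw [mem_sphere_zero_iff_norm] at hx₀ hy
  set P := jointValue T₁ T₂ x₀ with hP
  set R := jointValue T₁ T₂ y with hR
  have hT₁ : Continuous T₁ := T₁.continuous_of_finiteDimensional
  have hT₂ : Continuous T₂ := T₂.continuous_of_finiteDimensional
  -- `n` is normal to the direction `m` of the segment
  set m := R - P with hm
  have hm0 : 0 < m.1 * m.1 + m.2 * m.2 := by
    have : m.1 ≠ 0 ∨ m.2 ≠ 0 := by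
      by_contra! hcon
      exact hne (sub_eq_zero.1 (Prod.ext hcon.1 hcon.2 : m = 0)).symm
    rcases this with h | h <;> nlinarith [mul_self_pos.2 h, mul_self_nonneg m.1, mul_self_nonneg m.2]
  set c : ℝ := -m.2 * P.1 + m.1 * P.2 with hc
  have hcR : -m.2 * R.1 + m.1 * R.2 = c := by
    simp only [hc, hm, Prod.fst_sub, Prod.snd_sub]; ring
  set S : V →ₗ[ℂ] V := ((-m.2 : ℝ) : ℂ) • T₁ + ((m.1 : ℝ) : ℂ) • T₂ with hS
  set H : V →ₗ[ℂ] V := ((1 : ℝ) : ℂ) • S + ((-c : ℝ) : ℂ) • LinearMap.id with hH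
  have hSsym : S.IsSymmetric := h₁.real_linearCombination h₂ _ _
  have hHsym : H.IsSymmetric := hSsym.real_linearCombination LinearMap.IsSymmetric.id _ _
  have hHval : ∀ z : V, (inner ℂ z (H z)).re =
      -m.2 * (jointValue T₁ T₂ z).1 + m.1 * (jointValue T₁ T₂ z).2 - c * ‖z‖ ^ 2 := by
    intro z
    have h := re_inner_real_linearCombination S LinearMap.id 1 (-c) z
    have h' := re_inner_real_linearCombination T₁ T₂ (-m.2) m.1 z
    rw [← hS] at h'
    rw [← hH] at h
    have hid : (inner ℂ z z).re = ‖z‖ ^ 2 := by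
      rw [inner_self_eq_norm_sq_to_K]; norm_cast
    rw [h]
    simp only [jointValue, LinearMap.id_apply, hid] at h' ⊢
    rw [h']
    ring
  obtain ⟨l, hl, hl0⟩ := exists_unit_smul_re_eq_zero (starRingEnd ℂ (inner ℂ x₀ (H y)))
  obtain ⟨x, hx⟩ : ∃ x, x = l • x₀ := ⟨_, rfl⟩
  have hxn : ‖x‖ = 1 := by rw [hx, norm_smul, hl, hx₀, one_mul]
  have hxP : jointValue T₁ T₂ x = P := by rw [hx, jointValue_smul, hl]; simp [hP]
  have hcross : (inner ℂ x (H y)).re = 0 := by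
    rw [hx, inner_smul_left, ← Complex.conj_re, map_mul, Complex.conj_conj]
    exact hl0
  set z : ℝ → V := fun s => ((1 - s : ℝ) : ℂ) • x + (s : ℂ) • y with hz
  have hzc : Continuous z := by fun_prop
  have hzH : ∀ s, (inner ℂ (z s) (H (z s))).re = 0 := by
    intro s
    rw [hz, hHsym.re_inner_map_add, re_inner_map_smul, re_inner_map_smul, map_smul,
      inner_smul_left, inner_smul_right, Complex.conj_ofReal, Complex.re_ofReal_mul,
      Complex.re_ofReal_mul, hcross, hHval, hHval, hxP, ← hR, hxn, hy, hcR, ← hc]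
    ring
  have hz0 : ∀ s ∈ Icc (0 : ℝ) 1, z s ≠ 0 := by
    intro s hs h
    have hxy : ((1 - s : ℝ) : ℂ) • x = -((s : ℂ) • y) := eq_neg_of_add_eq_zero_left h
    have hn := congrArg norm hxy
    rw [norm_neg, norm_smul, norm_smul, hxn, hy, Complex.norm_real, Complex.norm_real,
      Real.norm_of_nonneg hs.1, Real.norm_of_nonneg (by linarith [hs.2])] at hn
    have hs2 : s = 1 / 2 := by linarith
    subst hs2
    have hv := congrArg (jointValue T₁ T₂) hxy
    rw [← neg_smul, jointValue_smul, jointValue_smul, hxP, ← hR] at hv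
    norm_num at hv
    exact hne hv
  have hJc : Continuous fun s => jointValue T₁ T₂ (z s) := by
    unfold jointValue; fun_prop
  set g : ℝ → ℝ := fun s =>
    (m.1 * (jointValue T₁ T₂ (z s)).1 + m.2 * (jointValue T₁ T₂ (z s)).2) / ‖z s‖ ^ 2 with hg
  have hgc : ContinuousOn g (Icc 0 1) := by
    refine ContinuousOn.div (by fun_prop) (by fun_prop) fun s hs => ?_
    exact pow_ne_zero 2 (norm_ne_zero_iff.2 (hz0 s hs))
  have hg0 : g 0 = m.1 * P.1 + m.2 * P.2 := by simp [hg, hz, hxP, hxn]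
  have hg1 : g 1 = m.1 * R.1 + m.2 * R.2 := by simp [hg, hz, hy, ← hR]
  rintro w ⟨α, β, hα, hβ, hαβ, rfl⟩
  have hα' : α = 1 - β := by linarith
  subst hα'
  have hmRP : m.1 * R.1 + m.2 * R.2 = m.1 * P.1 + m.2 * P.2 + (m.1 * m.1 + m.2 * m.2) := by
    simp only [hm, Prod.fst_sub, Prod.snd_sub]; ring
  obtain ⟨s, hs, hgs⟩ := intermediate_value_Icc zero_le_one hgc
    (show m.1 * P.1 + m.2 * P.2 + β * (m.1 * m.1 + m.2 * m.2) ∈ Icc (g 0) (g 1) by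
      rw [hg0, hg1, hmRP]
      constructor <;> nlinarith)
  have hzn : ‖z s‖ ≠ 0 := norm_ne_zero_iff.2 (hz0 s hs)
  refine ⟨((‖z s‖⁻¹ : ℝ) : ℂ) • z s, ?_, ?_⟩
  · rw [mem_sphere_zero_iff_norm, norm_smul, Complex.norm_real, norm_inv, norm_norm,
      inv_mul_cancel₀ hzn]
  · rw [jointValue_smul, Complex.norm_real, norm_inv, norm_norm]
    have hH0 := hzH s
    rw [hHval] at hH0
    simp only [hg] at hgs
    rw [div_eq_iff (pow_ne_zero 2 hzn)] at hgs
    generalize jointValue T₁ T₂ (z s) = q at *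
    have hR1 : R.1 = P.1 + m.1 := by simp [hm]
    have hR2 : R.2 = P.2 + m.2 := by simp [hm]
    have e1 : q.1 = ‖z s‖ ^ 2 * (P.1 + β * m.1) := by
      apply mul_left_cancel₀ hm0.ne'
      linear_combination m.1 * hgs - m.2 * hH0 - m.2 * ‖z s‖ ^ 2 * hc
    have e2 : q.2 = ‖z s‖ ^ 2 * (P.2 + β * m.2) := by
      apply mul_left_cancel₀ hm0.ne'
      linear_combination m.2 * hgs + m.1 * hH0 + m.1 * ‖z s‖ ^ 2 * hc
    ext
    · simp only [Prod.smul_fst, Prod.fst_add, smul_eq_mul, e1, hR1]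
      field_simp
      ring
    · simp only [Prod.smul_snd, Prod.snd_add, smul_eq_mul, e2, hR2]
      field_simp
      ring

/-- A unit vector at which the quadratic form of a symmetric operator is maximal over the unit
sphere is an eigenvector. -/
lemma LinearMap.IsSymmetric.apply_eq_smul_of_forall_re_inner_le {T : V →ₗ[ℂ] V}
    (hT : T.IsSymmetric) {c : ℝ} (hle : ∀ y : V, ‖y‖ = 1 → (inner ℂ y (T y)).re ≤ c) {x : V}
    (hx : ‖x‖ = 1) (hxc : (inner ℂ x (T x)).re = c) : T x = (c : ℂ) • x := by
  have hle' : ∀ y : V, (inner ℂ y (T y)).re ≤ c * ‖y‖ ^ 2 := by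
    intro y
    by_cases hy : y = 0
    · simp [hy]
    have hyn : ‖y‖ ≠ 0 := norm_ne_zero_iff.2 hy
    have h := hle (((‖y‖⁻¹ : ℝ) : ℂ) • y) (by
      rw [norm_smul, Complex.norm_real, norm_inv, norm_norm, inv_mul_cancel₀ hyn])
    rw [re_inner_map_smul, Complex.norm_real, norm_inv, norm_norm, inv_pow,
      inv_mul_le_iff₀ (by positivity)] at h
    linarith
  set w := T x - (c : ℂ) • x with hw
  have hcross : (inner ℂ x (T w)).re - c * (inner ℂ x w).re = ‖w‖ ^ 2 := by
    have h : (inner ℂ w w).re = ‖w‖ ^ 2 := by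
      rw [inner_self_eq_norm_sq_to_K]; norm_cast
    rw [← h]
    nth_rw 3 [hw]
    rw [inner_sub_left, inner_smul_left, hT x w, Complex.conj_ofReal, Complex.sub_re,
      Complex.re_ofReal_mul]
  have hquad : ∀ t : ℝ, 2 * t * ‖w‖ ^ 2 ≤ t ^ 2 * (c * ‖w‖ ^ 2 - (inner ℂ w (T w)).re) := by
    intro t
    have h := hle' (x + (t : ℂ) • w)
    rw [hT.re_inner_map_add, re_inner_map_smul, map_smul, inner_smul_right,
      Complex.re_ofReal_mul, hxc, @norm_add_sq ℂ, norm_smul, inner_smul_right, hx,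
      Complex.norm_real, mul_pow, Real.norm_eq_abs, sq_abs] at h
    simp only [RCLike.re_to_complex, Complex.re_ofReal_mul] at h
    linear_combination h - 2 * t * hcross
  have hw0 : ‖w‖ ^ 2 = 0 := by
    set D := c * ‖w‖ ^ 2 - (inner ℂ w (T w)).re with hD
    by_contra hne
    have hpos : 0 < ‖w‖ ^ 2 := lt_of_le_of_ne (sq_nonneg _) (Ne.symm hne)
    have hDpos : 0 < D := by have := hquad 1; linarith
    have h := hquad (‖w‖ ^ 2 / D)
    have h2 : (‖w‖ ^ 2 / D) ^ 2 * D = ‖w‖ ^ 2 / D * ‖w‖ ^ 2 := by field_simp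
    rw [h2] at h
    have : 0 < ‖w‖ ^ 2 / D * ‖w‖ ^ 2 := by positivity
    linarith
  have : w = 0 := norm_eq_zero.1 (pow_eq_zero_iff two_ne_zero |>.1 hw0)
  exact sub_eq_zero.1 this

/-- Vectors generating a corner point are joint eigenvectors. -/
lemma IsCornerPoint.apply_eq_smul {T₁ T₂ : V →ₗ[ℂ] V} (h₁ : T₁.IsSymmetric)
    (h₂ : T₂.IsSymmetric) {p : ℝ × ℝ}
    (hcor : IsCornerPoint (jointValue T₁ T₂ '' Metric.sphere 0 1) p) {x : V} (hx : ‖x‖ = 1)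
    (hxp : jointValue T₁ T₂ x = p) : T₁ x = (p.1 : ℂ) • x ∧ T₂ x = (p.2 : ℂ) • x := by
  obtain ⟨φ, χ, hdet, hφ, hχ⟩ := hcor.exists_functionals
  have key : ∀ ψ : (ℝ × ℝ) →ₗ[ℝ] ℝ,
      (∀ q ∈ jointValue T₁ T₂ '' Metric.sphere 0 1, ψ q ≤ ψ p) →
      ((ψ (1, 0) : ℝ) : ℂ) • T₁ x + ((ψ (0, 1) : ℝ) : ℂ) • T₂ x = ((ψ p : ℝ) : ℂ) • x := by
    intro ψ hψ
    refine (h₁.real_linearCombination h₂ (ψ (1, 0))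
      (ψ (0, 1))).apply_eq_smul_of_forall_re_inner_le (fun y hy => ?_) hx ?_
    · rw [re_inner_real_linearCombination, ← linearMap_prod_apply]
      exact hψ _ ⟨y, by simpa using hy, rfl⟩
    · rw [re_inner_real_linearCombination, ← linearMap_prod_apply, hxp]
  have hφx := key φ hφ
  have hχx := key χ hχ
  rw [linearMap_prod_apply φ p] at hφx
  rw [linearMap_prod_apply χ p] at hχx
  have hdet' : ((φ (1, 0) : ℝ) : ℂ) * (χ (0, 1) : ℝ) - (φ (0, 1) : ℝ) * (χ (1, 0) : ℝ) ≠ 0 := by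
    exact_mod_cast hdet
  push_cast at hφx hχx
  generalize ((φ (1, 0) : ℝ) : ℂ) = α at *
  generalize ((φ (0, 1) : ℝ) : ℂ) = β at *
  generalize ((χ (1, 0) : ℝ) : ℂ) = γ at *
  generalize ((χ (0, 1) : ℝ) : ℂ) = δ at *
  constructor
  · apply smul_right_injective V hdet'
    simp only
    linear_combination (norm := module) δ • hφx - β • hχx
  · apply smul_right_injective V hdet'
    simp only
    linear_combination (norm := module) α • hχx - γ • hφx

lemma isSimplicialPoint_of_isCornerPoint_jointValue [FiniteDimensional ℂ V] {T₁ T₂ : V →ₗ[ℂ] V}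
    (h₁ : T₁.IsSymmetric) (h₂ : T₂.IsSymmetric) {p : ℝ × ℝ}
    (hcor : IsCornerPoint (jointValue T₁ T₂ '' Metric.sphere 0 1) p) :
    IsSimplicialPoint (jointValue T₁ T₂ '' Metric.sphere 0 1) p := by
  have hT₁ : Continuous T₁ := T₁.continuous_of_finiteDimensional
  have hT₂ : Continuous T₂ := T₂.continuous_of_finiteDimensional
  have hJ : Continuous (jointValue T₁ T₂) := by unfold jointValue; fun_prop
  have : ProperSpace V := FiniteDimensional.proper ℂ V
  -- the joint eigenspace at `p`
  set E : Submodule ℂ V :=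
    Module.End.eigenspace T₁ (p.1 : ℂ) ⊓ Module.End.eigenspace T₂ (p.2 : ℂ) with hE
  have hEmem : ∀ e, e ∈ E ↔ T₁ e = (p.1 : ℂ) • e ∧ T₂ e = (p.2 : ℂ) • e := by
    intro e; rw [hE, Submodule.mem_inf, Module.End.mem_eigenspace_iff, Module.End.mem_eigenspace_iff]
  set K : Set (ℝ × ℝ) := jointValue T₁ T₂ '' (Metric.sphere 0 1 ∩ (Eᗮ : Set V)) with hK
  have hKc : IsCompact K :=
    ((isCompact_sphere 0 1).inter_right E.isClosed_orthogonal).image hJ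
  refine hcor.isSimplicialPoint (convex_image_jointValue_sphere h₁ h₂) hKc
    (image_mono inter_subset_left) ?_ ?_
  · rintro ⟨x, ⟨hx, hxE⟩, hxp⟩
    rw [mem_sphere_zero_iff_norm] at hx
    have hxE' : x ∈ E := (hEmem x).2 (hcor.apply_eq_smul h₁ h₂ hx hxp)
    have h0 : inner ℂ x x = 0 := Submodule.inner_right_of_mem_orthogonal hxE' hxE
    rw [inner_self_eq_zero] at h0
    rw [h0, norm_zero] at hx
    exact zero_ne_one hx
  · rintro _ ⟨z, hz, rfl⟩
    rw [mem_sphere_zero_iff_norm] at hz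
    obtain ⟨e, he, f, hf, rfl⟩ := E.exists_add_mem_mem_orthogonal z
    have hef : inner ℂ e f = 0 := Submodule.inner_right_of_mem_orthogonal he hf
    have hnorm : ‖e‖ ^ 2 + ‖f‖ ^ 2 = 1 := by
      have := norm_add_sq_eq_norm_sq_add_norm_sq_of_inner_eq_zero e f hef
      rw [hz] at this
      linarith
    have hee : (inner ℂ e e).re = ‖e‖ ^ 2 := by
      rw [inner_self_eq_norm_sq_to_K]; norm_cast
    obtain ⟨he₁, he₂⟩ := (hEmem e).1 he
    have hval : ∀ T : V →ₗ[ℂ] V, T.IsSymmetric → ∀ c : ℝ, T e = (c : ℂ) • e →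
        (inner ℂ (e + f) (T (e + f))).re = ‖e‖ ^ 2 * c + (inner ℂ f (T f)).re := by
      intro T hT c hc
      rw [hT.re_inner_map_add, ← hT e f, hc, inner_smul_left, inner_smul_right, hef,
        Complex.re_ofReal_mul, hee]
      simp [mul_comm]
    have hJv : jointValue T₁ T₂ (e + f) = ‖e‖ ^ 2 • p + jointValue T₁ T₂ f := by
      ext
      · simpa [jointValue] using hval T₁ h₁ p.1 he₁
      · simpa [jointValue] using hval T₂ h₂ p.2 he₂
    by_cases hf0 : f = 0
    · left
      subst hf0
      rw [hJv]
      have : ‖e‖ ^ 2 = 1 := by simpa using hnorm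
      rw [this]
      simp [jointValue]
    · right
      have hfn : ‖f‖ ≠ 0 := norm_ne_zero_iff.2 hf0
      refine ⟨‖f‖ ^ 2, by positivity, _,
        ⟨((‖f‖⁻¹ : ℝ) : ℂ) • f, ⟨?_, Eᗮ.smul_mem _ hf⟩, rfl⟩, ?_⟩
      · rw [mem_sphere_zero_iff_norm, norm_smul, Complex.norm_real, norm_inv, norm_norm,
          inv_mul_cancel₀ hfn]
      · rw [jointValue_smul, Complex.norm_real, norm_inv, norm_norm, hJv, smul_sub, smul_smul,
          ← mul_pow, mul_inv_cancel₀ hfn, one_pow, one_smul, eq_sub_iff_add_eq'.2 hnorm]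
        module

end QuadraticForms

lemma jointNR_eq_image_jointValue {d : ℕ} (u₁ u₂ : Matrix (Fin d) (Fin d) ℂ) :
    jointNR u₁ u₂ =
      jointValue u₁.toEuclideanLin u₂.toEuclideanLin '' Metric.sphere 0 1 := by
  have hin : ∀ (u : Matrix (Fin d) (Fin d) ℂ) (x : EuclideanSpace ℂ (Fin d)),
      inner ℂ x (u.toEuclideanLin x) = star x.ofLp ⬝ᵥ u.mulVec x.ofLp := by
    intro u x
    rw [EuclideanSpace.inner_eq_star_dotProduct, dotProduct_comm, Matrix.ofLp_toLpLin]
    rfl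
  have hnorm : ∀ x : EuclideanSpace ℂ (Fin d), star x.ofLp ⬝ᵥ x.ofLp = 1 ↔ ‖x‖ = 1 := by
    intro x
    rw [dotProduct_comm, ← EuclideanSpace.inner_eq_star_dotProduct, inner_self_eq_norm_sq_to_K]
    rw [← RCLike.ofReal_pow, ← RCLike.ofReal_one, RCLike.ofReal_inj]
    exact pow_eq_one_iff_of_nonneg (norm_nonneg x) two_ne_zero
  ext p
  constructor
  · rintro ⟨x, hx, rfl⟩
    refine ⟨WithLp.toLp 2 x, ?_, ?_⟩
    · rw [mem_sphere_zero_iff_norm, ← hnorm]; exact hx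
    · simp only [jointValue, hin]
  · rintro ⟨x, hx, rfl⟩
    rw [mem_sphere_zero_iff_norm, ← hnorm] at hx
    exact ⟨x.ofLp, hx, by simp only [jointValue, hin]⟩

theorem round_or_simplicial_but_not_both {d : ℕ} (u₁ u₂ : Matrix (Fin d) (Fin d) ℂ)
    (h₁ : u₁.IsHermitian) (h₂ : u₂.IsHermitian) :
    ∀ p ∈ jointNR u₁ u₂,
      Xor' (IsRoundBoundaryPoint (jointNR u₁ u₂) p)
           (IsSimplicialPoint (jointNR u₁ u₂) p) := by
  have hs₁ := Matrix.isSymmetric_toEuclideanLin_iff.2 h₁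
  have hs₂ := Matrix.isSymmetric_toEuclideanLin_iff.2 h₂
  rw [jointNR_eq_image_jointValue]
  set C := jointValue u₁.toEuclideanLin u₂.toEuclideanLin '' Metric.sphere 0 1
  intro p hp
  have hC : Convex ℝ C := convex_image_jointValue_sphere hs₁ hs₂
  have hcl : IsClosed C := by
    have hT₁ : Continuous u₁.toEuclideanLin := LinearMap.continuous_of_finiteDimensional _
    have hT₂ : Continuous u₂.toEuclideanLin := LinearMap.continuous_of_finiteDimensional _
    refine ((isCompact_sphere _ _).image ?_).isClosed
    unfold jointValue
    fun_prop
  by_cases hsim : IsSimplicialPoint C p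
  · exact Or.inr ⟨hsim, not_isRoundBoundaryPoint_of_isSimplicialPoint hC hp hsim⟩
  · refine Or.inl ⟨⟨⟨subset_closure hp, ?_⟩, ?_, ?_⟩, hsim⟩
    · exact fun h => hsim (isSimplicialPoint_of_mem_interior hC h)
    · exact fun h => hsim (isSimplicialPoint_of_isCornerPoint_jointValue hs₁ hs₂ h)
    · rintro ⟨a, b, hab, hseg, hpab⟩
      exact hsim (isSimplicialPoint_of_flat hC hcl hab hseg hpab)
end
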